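/- arXiv:1412.2993 — 2 statements merged into one kernel-verified Lean document; each statement's English description precedes it below -/
import Mathlib

section
/- Every monic polynomial of odd degree with computable real coefficients has a computable real root: if P(X) = X^{2n+1} + a_{2n} X^{2n} + ⋯ + a_1 X + a_0 where each coefficient a_j is a computable real, then there exists a computable real r with P(r) = 0. -/
open Finset

/-- A real number `r` is computable if some computable sequence of rationals
approximates it to within `2 ^ (-n)` for every `n`. -/
def ComputableReal (r : ℝ) : Prop :=
  ∃ f : ℕ → ℚ, Computable f ∧ ∀ n : ℕ, |r - (f n : ℝ)| ≤ 2 ^ (-(n : ℤ))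

namespace Computable

/-- Unbounded search: a computable total relation has a computable choice function. -/
theorem exists_choice {α β : Type*} [Primcodable α] [Denumerable β] {R : α → β → Prop}
    (hR : ComputablePred fun p : α × β => R p.1 p.2) (hex : ∀ a, ∃ b, R a b) :
    ∃ f : α → β, Computable f ∧ ∀ a, R a (f a) := by
  classical
  have hex' : ∀ a, ∃ n, R a (Denumerable.ofNat β n) := fun a => by
    obtain ⟨b, hb⟩ := hex a
    exact ⟨Encodable.encode b, by simpa using hb⟩
  have hR' : ComputablePred fun p : α × ℕ => R p.1 (Denumerable.ofNat β p.2) :=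
    (hR.decide.comp (fst.pair ((Computable.ofNat β).comp snd))).computablePred
  exact ⟨_, (Computable.ofNat β).comp (Computable.find hR' hex'), fun a => Nat.find_spec (hex' a)⟩

/-- A function with computable graph is computable. -/
theorem of_graph {α β : Type*} [Primcodable α] [Denumerable β] {f : α → β}
    (hf : ComputablePred fun p : α × β => p.2 = f p.1) : Computable f := by
  obtain ⟨g, hg, hgf⟩ := exists_choice (R := fun a b => b = f a) hf fun a => ⟨_, rfl⟩
  exact hg.of_eq hgf

end Computable

theorem ComputablePred.and {α : Type*} [Primcodable α] {p q : α → Prop}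
    (hp : ComputablePred p) (hq : ComputablePred q) : ComputablePred fun a => p a ∧ q a := by
  classical
  exact ((Primrec.and.to_comp.comp hp.decide hq.decide).of_eq fun a => by simp).computablePred

/-- The increasing enumeration of a decidable infinite set of naturals is computable. -/
theorem Nat.Subtype.computable_coe_ofNat {s : Set ℕ} [DecidablePred (· ∈ s)] [Infinite s]
    (hs : ComputablePred (· ∈ s)) : Computable fun n => (Nat.Subtype.ofNat s n : ℕ) := by
  have hex : ∀ x : ℕ, ∃ k, x + k + 1 ∈ s := fun x => by
    obtain ⟨y, hy, hxy⟩ := (Set.infinite_coe_iff.1 ‹Infinite s›).exists_gt x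
    exact ⟨y - x - 1, by rwa [show x + (y - x - 1) + 1 = y by omega]⟩
  have hadd : Computable₂ fun x k : ℕ => x + k + 1 :=
    Computable.succ.comp Primrec.nat_add.to_comp
  have hP : ComputablePred fun p : ℕ × ℕ => p.1 + p.2 + 1 ∈ s :=
    (hs.decide.comp hadd).computablePred
  have hnext : Computable fun x => x + Nat.find (hex x) + 1 :=
    hadd.comp .id (Computable.find (P := fun x k => x + k + 1 ∈ s) hP hex)
  refine (Computable.nat_rec (h := fun _ p => p.2 + Nat.find (hex p.2) + 1) .id
    (.const ((⊥ : s) : ℕ)) (hnext.comp (.comp .snd .snd))).of_eq fun n => ?_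
  induction n with
  | zero => rfl
  | succ n ih =>
    simp only [id] at ih ⊢
    rw [ih]
    rfl

theorem Primrec.nat_dvd : PrimrecRel ((· ∣ ·) : ℕ → ℕ → Prop) :=
  (Primrec.eq.comp (Primrec.nat_mod.comp .snd .fst) (.const 0)).of_eq fun _ =>
    (Nat.dvd_iff_mod_eq_zero).symm

theorem Nat.coprime_iff_forall_lt {a b : ℕ} (hb : 0 < b) :
    a.Coprime b ↔ ∀ k < b + 1, ¬ (k ∣ a ∧ k ∣ b ∧ k ≠ 1) := by
  refine ⟨fun h k _ hk => hk.2.2 (Nat.eq_one_of_dvd_coprimes h hk.1 hk.2.1), fun h => ?_⟩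
  by_contra hne
  exact h _ (Nat.lt_succ_of_le (Nat.gcd_le_right a hb))
    ⟨Nat.gcd_dvd_left a b, Nat.gcd_dvd_right a b, hne⟩

theorem Primrec.pos_and_coprime :
    PrimrecRel fun a b : ℕ => 0 < b ∧ a.Coprime b := by
  have hR : PrimrecRel fun (k : ℕ) (p : ℕ × ℕ) => ¬ (k ∣ p.1 ∧ k ∣ p.2 ∧ k ≠ 1) :=
    ((Primrec.nat_dvd.comp .fst (.comp .fst .snd)).and
      ((Primrec.nat_dvd.comp .fst (.comp .snd .snd)).and
        (Primrec.eq.comp .fst (.const 1)).not)).not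
  have hall : PrimrecRel fun (L : List ℕ) (p : ℕ × ℕ) =>
    ∀ k ∈ L, ¬ (k ∣ p.1 ∧ k ∣ p.2 ∧ k ≠ 1) := hR.forall_mem_list
  refine ((Primrec.nat_lt.comp (.const 0) .snd).and
    (hall.comp (Primrec.list_range.comp (Primrec.succ.comp .snd)) .id)).of_eq fun p => ?_
  refine and_congr_right fun hp => ?_
  simp only [Nat.coprime_iff_forall_lt hp, List.mem_range, id, Nat.succ_eq_add_one]

namespace Rat

theorem encode_eq (q : ℚ) :
    Rat.instEncodable.encode q = Nat.pair (Equiv.intEquivNat q.num) q.den := rfl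

theorem encode_int_even (k : ℕ) : Equiv.intEquivNat (k : ℤ) = 2 * k := rfl

theorem encode_int_odd (k : ℕ) : Equiv.intEquivNat (Int.negSucc k) = 2 * k + 1 := rfl

theorem natAbs_eq_encode (z : ℤ) : (Equiv.intEquivNat z + 1) / 2 = z.natAbs := by
  cases z with
  | ofNat k => have := encode_int_even k; simp at this ⊢; omega
  | negSucc k => have := encode_int_odd k; simp at this ⊢; omega


theorem mem_range_encode {n : ℕ} : n ∈ Set.range Rat.instEncodable.encode ↔
    0 < n.unpair.2 ∧ ((n.unpair.1 + 1) / 2).Coprime n.unpair.2 := by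
  constructor
  · rintro ⟨q, rfl⟩
    simpa [encode_eq, natAbs_eq_encode, q.pos] using q.reduced
  · rintro ⟨hpos, hcop⟩
    have hnum := Equiv.intEquivNat.apply_symm_apply n.unpair.1
    refine ⟨⟨Equiv.intEquivNat.symm n.unpair.1, n.unpair.2, hpos.ne', ?_⟩, ?_⟩
    · rwa [← natAbs_eq_encode, hnum]
    · simp [encode_eq, hnum]

/-- The code of a rational with respect to its numerator and denominator can be computed from its
code as an element of the denumerable type `ℚ`. -/
theorem computable_encode : Computable Rat.instEncodable.encode := by
  let _ : DecidablePred (· ∈ Set.range Rat.instEncodable.encode) :=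
    @Encodable.decidableRangeEncode ℚ Rat.instEncodable
  have _ : Infinite (Set.range Rat.instEncodable.encode) :=
    (Set.infinite_range_of_injective Rat.instEncodable.encode_injective).to_subtype
  have hS : PrimrecPred (· ∈ Set.range Rat.instEncodable.encode) :=
    (Primrec.pos_and_coprime.comp
      (Primrec.nat_div.comp (Primrec.succ.comp (Primrec.fst.comp .unpair)) (.const 2))
      (Primrec.snd.comp .unpair)).of_eq fun n => mem_range_encode.symm
  refine ((Nat.Subtype.computable_coe_ofNat hS.computablePred).comp .encode).of_eq fun q => ?_
  have key : ∀ n, Denumerable.ofNat ℚ n = (@Encodable.equivRangeEncode ℚ Rat.instEncodable).symm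
    (Nat.Subtype.ofNat (Set.range Rat.instEncodable.encode) n) := fun n => rfl
  have h := key (@Encodable.encode ℚ Rat.instDenumerable.toEncodable q)
  rw [Denumerable.ofNat_encode, Equiv.eq_symm_apply] at h
  rw [← h]
  rfl

/-- The rational represented by a difference of naturals over a positive denominator. -/
def ofTriple (t : ℕ × ℕ × ℕ) : ℚ := ((t.1 : ℚ) - t.2.1) / (t.2.2 + 1)

/-- A representation of a rational as a difference of naturals over a positive denominator. -/
def toTriple (q : ℚ) : ℕ × ℕ × ℕ := (q.num.toNat, (-q.num).toNat, q.den - 1)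

theorem ofTriple_toTriple (q : ℚ) : ofTriple (toTriple q) = q := by
  have hden : ((q.den - 1 : ℕ) : ℚ) + 1 = q.den := by
    exact_mod_cast Nat.sub_add_cancel q.pos
  have hnum : ((q.num.toNat : ℕ) : ℚ) - ((-q.num).toNat : ℕ) = q.num := by
    exact_mod_cast Int.toNat_sub_toNat_neg q.num
  simp only [ofTriple, toTriple, hden, hnum, Rat.num_div_den]

theorem toNat_eq_encode (z : ℤ) :
    z.toNat = bif (Equiv.intEquivNat z).bodd then 0 else (Equiv.intEquivNat z).div2 := by
  cases z with
  | ofNat k => have := encode_int_even k; simp at this ⊢; simp [this, Nat.div2_val]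
  | negSucc k => have := encode_int_odd k; simp [this, Nat.div2_val]

theorem toNat_neg_eq_encode (z : ℤ) : (-z).toNat =
    bif (Equiv.intEquivNat z).bodd then (Equiv.intEquivNat z).div2 + 1 else 0 := by
  cases z with
  | ofNat k => have := encode_int_even k; simp at this ⊢; simp [this]
  | negSucc k =>
    have := encode_int_odd k
    rw [this, Int.neg_negSucc]
    simp [Nat.div2_val]

theorem computable_toTriple : Computable toTriple := by
  have hnum : Computable fun q : ℚ => Equiv.intEquivNat q.num :=
    (Computable.fst.comp (Computable.unpair.comp computable_encode)).of_eq fun q => by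
      simp [encode_eq]
  have hden : Computable Rat.den :=
    (Computable.snd.comp (Computable.unpair.comp computable_encode)).of_eq fun q => by
      simp [encode_eq]
  have hodd := Computable.nat_bodd.comp hnum
  have hdiv := Computable.nat_div2.comp hnum
  refine ((Computable.cond hodd (.const 0) hdiv).pair
    ((Computable.cond hodd (Computable.succ.comp hdiv) (.const 0)).pair
      (Computable.pred.comp hden))).of_eq fun q => ?_
  rw [toTriple, toNat_neg_eq_encode, toNat_eq_encode]
  rfl

theorem ofTriple_eq_iff (s t : ℕ × ℕ × ℕ) : ofTriple s = ofTriple t ↔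
    s.1 * (t.2.2 + 1) + t.2.1 * (s.2.2 + 1) = t.1 * (s.2.2 + 1) + s.2.1 * (t.2.2 + 1) := by
  have hs : (s.2.2 : ℚ) + 1 ≠ 0 := by positivity
  have ht : (t.2.2 : ℚ) + 1 ≠ 0 := by positivity
  rw [ofTriple, ofTriple, div_eq_div_iff hs ht, ← @Nat.cast_inj ℚ]
  push_cast
  constructor <;> intro h <;> linarith

theorem ofTriple_lt_iff (s t : ℕ × ℕ × ℕ) : ofTriple s < ofTriple t ↔
    s.1 * (t.2.2 + 1) + t.2.1 * (s.2.2 + 1) < t.1 * (s.2.2 + 1) + s.2.1 * (t.2.2 + 1) := by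
  have hs : 0 < (s.2.2 : ℚ) + 1 := by positivity
  have ht : 0 < (t.2.2 : ℚ) + 1 := by positivity
  rw [ofTriple, ofTriple, div_lt_div_iff₀ hs ht, ← @Nat.cast_lt ℚ]
  push_cast
  constructor <;> intro h <;> linarith

section

variable {α : Type*} [Primcodable α] {f g : α → ℚ} {a b : α → ℕ}

theorem _root_.Computable.natAdd (ha : Computable a) (hb : Computable b) :
    Computable fun x => a x + b x := Primrec.nat_add.to_comp.comp ha hb

theorem _root_.Computable.natMul (ha : Computable a) (hb : Computable b) :
    Computable fun x => a x * b x := Primrec.nat_mul.to_comp.comp ha hb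

/-- The two sides of the cross-multiplied comparison of two represented rationals. -/
theorem computable_cross {s t : α → ℕ × ℕ × ℕ} (hs : Computable s) (ht : Computable t) :
    Computable fun x => (s x).1 * ((t x).2.2 + 1) + (t x).2.1 * ((s x).2.2 + 1) :=
  (Computable.natMul (.comp .fst hs) (.comp .succ (.comp .snd (.comp .snd ht)))).natAdd
    (Computable.natMul (.comp .fst (.comp .snd ht)) (.comp .succ (.comp .snd (.comp .snd hs))))

theorem computable_ofTriple : Computable ofTriple := by
  refine .of_graph (((Primrec.eq (α := ℕ)).decide.to_comp.comp
    (computable_cross (computable_toTriple.comp .snd) .fst)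
    (computable_cross .fst (computable_toTriple.comp .snd))).computablePred.of_eq fun p => ?_)
  conv_rhs => rw [← ofTriple_toTriple p.2, ofTriple_eq_iff]

theorem _root_.ComputablePred.rat_lt (hf : Computable f) (hg : Computable g) :
    ComputablePred fun x => f x < g x := by
  have hf' := computable_toTriple.comp hf
  have hg' := computable_toTriple.comp hg
  refine ((Primrec.nat_lt.decide.to_comp.comp (computable_cross hf' hg')
    (computable_cross hg' hf')).computablePred.of_eq fun x => ?_)
  conv_rhs => rw [← ofTriple_toTriple (f x), ← ofTriple_toTriple (g x), ofTriple_lt_iff]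

theorem _root_.Computable.rat_add (hf : Computable f) (hg : Computable g) :
    Computable fun x => f x + g x := by
  have hf' := computable_toTriple.comp hf
  have hg' := computable_toTriple.comp hg
  have hfd := Computable.snd.comp (.comp .snd hf')
  have hgd := Computable.snd.comp (.comp .snd hg')
  have hfs := Computable.succ.comp hfd
  have hgs := Computable.succ.comp hgd
  refine (computable_ofTriple.comp
    (((Computable.natMul (.comp .fst hf') hgs).natAdd (Computable.natMul (.comp .fst hg') hfs)).pair
    (((Computable.natMul (.comp .fst (.comp .snd hf')) hgs).natAdd
      (Computable.natMul (.comp .fst (.comp .snd hg')) hfs)).pair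
    ((hfd.natMul hgs).natAdd hgd)))).of_eq fun x => ?_
  conv_rhs => rw [← ofTriple_toTriple (f x), ← ofTriple_toTriple (g x)]
  simp only [ofTriple]
  push_cast
  field_simp
  ring

theorem _root_.Computable.rat_mul (hf : Computable f) (hg : Computable g) :
    Computable fun x => f x * g x := by
  have hf' := computable_toTriple.comp hf
  have hg' := computable_toTriple.comp hg
  have hf1 := Computable.fst.comp hf'
  have hg1 := Computable.fst.comp hg'
  have hf2 := Computable.fst.comp (.comp .snd hf')
  have hg2 := Computable.fst.comp (.comp .snd hg')
  have hfd := Computable.snd.comp (.comp .snd hf')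
  have hgd := Computable.snd.comp (.comp .snd hg')
  refine (computable_ofTriple.comp (((hf1.natMul hg1).natAdd (hf2.natMul hg2)).pair
    (((hf1.natMul hg2).natAdd (hf2.natMul hg1)).pair
    ((hfd.natMul (.comp .succ hgd)).natAdd hgd)))).of_eq fun x => ?_
  conv_rhs => rw [← ofTriple_toTriple (f x), ← ofTriple_toTriple (g x)]
  simp only [ofTriple]
  push_cast
  field_simp
  ring

theorem _root_.Computable.rat_pow (hf : Computable f) (k : ℕ) : Computable fun x => f x ^ k := by
  induction k with
  | zero => simpa using Computable.const 1
  | succ k ih => simpa only [pow_succ] using ih.rat_mul hf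

theorem _root_.Computable.rat_sum {ι : Type*} {F : ι → α → ℚ} (s : Finset ι)
    (hF : ∀ i, Computable (F i)) : Computable fun x => ∑ i ∈ s, F i x := by
  classical
  induction s using Finset.induction_on with
  | empty => simpa using Computable.const 0
  | insert i s hi ih => simpa only [Finset.sum_insert hi] using (hF i).rat_add ih

theorem _root_.Computable.rat_const_pow (q : ℚ) : Computable fun n : ℕ => q ^ n := by
  refine (Computable.nat_rec (h := fun _ p => p.2 * q) .id (.const 1)
    (Computable.rat_mul (.comp .snd .snd) (.const q))).of_eq fun n => ?_
  induction n with
  | zero => exact (pow_zero q).symm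
  | succ n ih =>
    simp only [id] at ih ⊢
    rw [ih, pow_succ]

end

end Rat

namespace Polynomial

theorem Monic.tendsto_eval_atTop {p : Polynomial ℝ} (hp : p.Monic) (hdeg : 0 < p.natDegree) :
    Filter.Tendsto (fun x => p.eval x) Filter.atTop Filter.atTop :=
  p.tendsto_atTop_of_leadingCoeff_nonneg (natDegree_pos_iff_degree_pos.1 hdeg)
    (by simp [hp.leadingCoeff])

theorem Monic.exists_eval_neg {p : Polynomial ℝ} (hp : p.Monic) (hodd : Odd p.natDegree) :
    ∃ x, p.eval x < 0 := by
  have hdeg : (-p.comp (-X)).natDegree = p.natDegree := by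
    rw [natDegree_neg, natDegree_comp]; simp
  have hmonic : (-p.comp (-X)).Monic := by
    rw [Monic, leadingCoeff_neg, comp_neg_X_leadingCoeff_eq, hp.leadingCoeff, hodd.neg_one_pow]
    norm_num
  obtain ⟨x, hx⟩ := ((hmonic.tendsto_eval_atTop (hdeg ▸ hodd.pos)).eventually_gt_atTop 0).exists
  exact ⟨-x, by simpa using hx⟩

/-- A monic real polynomial of odd degree changes sign, from negative to positive, at some point
which is its only root in a neighbourhood. -/
theorem Monic.exists_sign_change {p : Polynomial ℝ} (hp : p.Monic) (hodd : Odd p.natDegree) :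
    ∃ r : ℝ, ∃ δ > 0, p.eval r = 0 ∧ (∀ x ∈ Set.Ioo (r - δ) r, p.eval x < 0) ∧
      ∀ x ∈ Set.Ioo r (r + δ), 0 < p.eval x := by
  set S : Set ℝ := {x | p.eval x < 0}
  have hne : S.Nonempty := hp.exists_eval_neg hodd
  have hbdd : BddAbove S := by
    obtain ⟨b, hb⟩ := Filter.eventually_atTop.1
      ((hp.tendsto_eval_atTop hodd.pos).eventually_ge_atTop 0)
    exact ⟨b, fun x hx => le_of_not_ge fun hbx => (hb x hbx).not_gt hx⟩
  have hright : ∀ x, sSup S < x → 0 ≤ p.eval x := fun x hx =>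
    not_lt.1 fun h => (le_csSup hbdd h).not_gt hx
  have hroot : p.eval (sSup S) = 0 := by
    refine le_antisymm ?_ ?_
    · have hcl : IsClosed {x | p.eval x ≤ 0} := isClosed_le p.continuous continuous_const
      exact closure_minimal (fun x (hx : p.eval x < 0) => hx.le) hcl (csSup_mem_closure hne hbdd)
    · have hcl : IsClosed {x | 0 ≤ p.eval x} := isClosed_le continuous_const p.continuous
      have hmem : sSup S ∈ closure (Set.Ioi (sSup S)) := by simp
      exact closure_minimal (fun x hx => hright x hx) hcl hmem
  obtain ⟨δ, hδ, hball⟩ : ∃ δ > 0, ∀ x, |x - sSup S| < δ → x ≠ sSup S → p.eval x ≠ 0 := by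
    have hfin : ({x | p.IsRoot x} \ {sSup S}).Finite := (finite_setOfPred_isRoot hp.ne_zero).sdiff
    obtain ⟨δ, hδ, hsub⟩ := Metric.mem_nhds_iff.1
      (hfin.isClosed.isOpen_compl.mem_nhds (show sSup S ∈ _ by simp))
    exact ⟨δ, hδ, fun x hx hxr h0 => hsub (by rwa [Metric.mem_ball, Real.dist_eq]) ⟨h0, hxr⟩⟩
  have hroots : ∀ x ∈ Set.Ioo (sSup S - δ) (sSup S), p.eval x ≠ 0 := fun x hx =>
    hball x (abs_lt.2 ⟨by linarith [hx.1], by linarith [hx.2]⟩) hx.2.ne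
  refine ⟨sSup S, δ, hδ, hroot, fun x hx => ?_, fun x hx => ?_⟩
  · by_contra! hx0
    obtain ⟨y, hy, hyδ⟩ := exists_lt_of_lt_csSup hne (sub_lt_self (sSup S) hδ)
    have hyr : y < sSup S := (le_csSup hbdd hy).lt_of_ne fun h => by
      rw [h] at hy; exact (ne_of_lt hy) hroot
    obtain ⟨z, hz, hz0⟩ := intermediate_value_uIcc (a := y) (b := x) p.continuous.continuousOn
      (Set.mem_uIcc_of_le (le_of_lt hy) hx0)
    exact hroots z (Set.OrdConnected.uIcc_subset Set.ordConnected_Ioo ⟨hyδ, hyr⟩ hx hz) hz0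
  · exact (hright x hx.1).lt_of_ne'
      (hball x (abs_lt.2 ⟨by linarith [hx.1], by linarith [hx.2]⟩) hx.1.ne')

end Polynomial

/-- A point at which a function changes sign is computable as soon as, near that point, the
function has computable rational approximations with uniformly small error at the rationals. -/
theorem ComputableReal.of_sign_change {P : ℝ → ℝ} {r δ C : ℝ} (hδ : 0 < δ)
    (hneg : ∀ x ∈ Set.Ioo (r - δ) r, P x < 0) (hpos : ∀ x ∈ Set.Ioo r (r + δ), 0 < P x)
    (hr : P r = 0) {Q : ℚ × ℕ → ℚ} (hQ : Computable Q)
    (happrox : ∀ (s : ℚ) (m : ℕ), (s : ℝ) ∈ Set.Ioo (r - δ) (r + δ) →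
      |P s - Q (s, m)| ≤ C * (1 / 2) ^ m) : ComputableReal r := by
  obtain ⟨a, ha₁, ha₂⟩ := exists_rat_btwn (sub_lt_self r hδ)
  obtain ⟨b, hb₁, hb₂⟩ := exists_rat_btwn (lt_add_of_pos_right r hδ)
  obtain ⟨K, hK⟩ := exists_rat_gt C
  let R : ℕ → ℚ × ℚ × ℕ → Prop := fun n p =>
    (a < p.1 ∧ p.2.1 < b) ∧ (p.1 < p.2.1 ∧ p.2.1 < p.1 + (1 / 2) ^ n) ∧
      Q (p.1, p.2.2) + K * (1 / 2) ^ p.2.2 < 0 ∧ K * (1 / 2) ^ p.2.2 < Q (p.2.1, p.2.2)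
  have hR : ComputablePred fun x : ℕ × ℚ × ℚ × ℕ => R x.1 x.2 := by
    have hs : Computable fun x : ℕ × ℚ × ℚ × ℕ => x.2.1 := .comp .fst .snd
    have ht : Computable fun x : ℕ × ℚ × ℚ × ℕ => x.2.2.1 := .comp .fst (.comp .snd .snd)
    have hm : Computable fun x : ℕ × ℚ × ℚ × ℕ => x.2.2.2 := .comp .snd (.comp .snd .snd)
    have herr : Computable fun x : ℕ × ℚ × ℚ × ℕ => K * (1 / 2) ^ x.2.2.2 :=
      .rat_mul (.const K) ((Computable.rat_const_pow _).comp hm)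
    exact ((ComputablePred.rat_lt (.const a) hs).and (.rat_lt ht (.const b))).and
      (((ComputablePred.rat_lt hs ht).and
        (.rat_lt ht (hs.rat_add ((Computable.rat_const_pow _).comp .fst)))).and
        ((ComputablePred.rat_lt ((hQ.comp (hs.pair hm)).rat_add herr) (.const 0)).and
          (.rat_lt herr (hQ.comp (ht.pair hm)))))
  have hle : ∀ m : ℕ, C * (1 / 2 : ℝ) ^ m ≤ K * (1 / 2) ^ m := fun m => by gcongr
  have hex : ∀ n, ∃ p, R n p := fun n => by
    have hn : (0 : ℝ) < (1 / 2) ^ n / 2 := by positivity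
    obtain ⟨s, hs₁, hs₂⟩ := exists_rat_btwn (max_lt ha₂ (sub_lt_self r hn))
    obtain ⟨t, ht₁, ht₂⟩ := exists_rat_btwn (lt_min hb₁ (lt_add_of_pos_right r hn))
    obtain ⟨has, hns⟩ := max_lt_iff.1 hs₁
    obtain ⟨htb, hnt⟩ := lt_min_iff.1 ht₂
    have hPs := hneg s ⟨by linarith, hs₂⟩
    have hPt := hpos t ⟨ht₁, by linarith⟩
    have hlim : Filter.Tendsto (fun m : ℕ => (2 * K : ℝ) * (1 / 2) ^ m) Filter.atTop (nhds 0) := by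
      simpa using (tendsto_pow_atTop_nhds_zero_of_lt_one (r := (1 / 2 : ℝ)) (by norm_num)
        (by norm_num)).const_mul (2 * K : ℝ)
    obtain ⟨m, hms, hmt⟩ := ((hlim.eventually_lt_const (neg_pos.2 hPs)).and
      (hlim.eventually_lt_const hPt)).exists
    have hQs := abs_le.1 (happrox s m ⟨by linarith, by linarith⟩)
    have hQt := abs_le.1 (happrox t m ⟨by linarith, by linarith⟩)
    have hm := hle m
    refine ⟨(s, t, m), ⟨?_, ?_⟩, ⟨?_, ?_⟩, ?_, ?_⟩
    · exact_mod_cast has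
    · exact_mod_cast htb
    · exact_mod_cast hs₂.trans ht₁
    · rw [← Rat.cast_lt (K := ℝ)]; push_cast; linarith
    · rw [← Rat.cast_lt (K := ℝ)]; push_cast; linarith [hQs.1]
    · rw [← Rat.cast_lt (K := ℝ)]; push_cast; linarith [hQt.2]
  obtain ⟨f, hf, hfR⟩ := Computable.exists_choice hR hex
  refine ⟨fun n => (f n).1, Computable.fst.comp hf, fun n => ?_⟩
  change |r - ((f n).1 : ℝ)| ≤ _
  obtain ⟨⟨has, htb⟩, ⟨hst, htn⟩, hQs, hQt⟩ := hfR n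
  generalize (f n).1 = s at *
  generalize (f n).2.1 = t at *
  generalize (f n).2.2 = m at *
  rw [← Rat.cast_lt (K := ℝ)] at has htb hst htn hQs hQt
  push_cast at htn hQs hQt
  have hm := hle m
  have hsr : (s : ℝ) < r := by
    by_contra! h
    have hQ' := abs_le.1 (happrox s m ⟨by linarith, by linarith⟩)
    rcases h.eq_or_lt with h | h
    · rw [← h, hr] at hQ'; linarith [hQ'.2]
    · linarith [hpos s ⟨h, by linarith⟩, hQ'.2]
  have hrt : r < (t : ℝ) := by
    by_contra! h
    have hQ' := abs_le.1 (happrox t m ⟨by linarith, by linarith⟩)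
    rcases h.eq_or_lt with h | h
    · rw [h, hr] at hQ'; linarith [hQ'.1]
    · linarith [hneg t ⟨by linarith, h⟩, hQ'.1]
  rw [zpow_neg, zpow_natCast, ← inv_pow, ← one_div, abs_le]
  constructor <;> linarith [pow_pos (one_half_pos (α := ℝ)) n]

/-- Every monic polynomial of odd degree with computable real coefficients has
a computable real root. -/
theorem computableReal_odd_degree_root (n : ℕ) (a : Fin (2 * n + 1) → ℝ)
    (ha : ∀ j, ComputableReal (a j)) :
    ∃ r : ℝ, ComputableReal r ∧
      r ^ (2 * n + 1) + ∑ j : Fin (2 * n + 1), a j * r ^ (j : ℕ) = 0 := by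
  choose f hf hfa using ha
  let p : Polynomial ℝ := Polynomial.X ^ (2 * n + 1) +
    ∑ j : Fin (2 * n + 1), Polynomial.C (a j) * Polynomial.X ^ (j : ℕ)
  have hlow : (∑ j : Fin (2 * n + 1), Polynomial.C (a j) * Polynomial.X ^ (j : ℕ)).degree <
      ((2 * n + 1 : ℕ) : WithBot ℕ) := Polynomial.degree_sum_fin_lt a
  have hmonic : p.Monic := Polynomial.monic_X_pow_add hlow
  have hdeg : p.natDegree = 2 * n + 1 := by
    rw [Polynomial.natDegree_add_eq_left_of_degree_lt (by rwa [Polynomial.degree_X_pow]),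
      Polynomial.natDegree_X_pow]
  have heval : ∀ x, p.eval x = x ^ (2 * n + 1) + ∑ j : Fin (2 * n + 1), a j * x ^ (j : ℕ) := by
    simp [p, Polynomial.eval_finsetSum]
  obtain ⟨r, δ, hδ, hr, hneg, hpos⟩ := hmonic.exists_sign_change (hdeg ▸ odd_two_mul_add_one n)
  let Q : ℚ × ℕ → ℚ := fun y =>
    y.1 ^ (2 * n + 1) + ∑ j : Fin (2 * n + 1), f j y.2 * y.1 ^ (j : ℕ)
  have hQ : Computable Q := (Computable.fst.rat_pow _).rat_add
    (.rat_sum _ fun j => ((hf j).comp .snd).rat_mul (Computable.fst.rat_pow _))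
  refine ⟨r, .of_sign_change (P := fun x => p.eval x)
    (C := ∑ j : Fin (2 * n + 1), (|r| + δ) ^ (j : ℕ)) hδ hneg hpos hr hQ fun s m hs => ?_,
    by rw [← heval, hr]⟩
  have hs' : |(s : ℝ)| ≤ |r| + δ :=
    abs_le.2 ⟨by linarith [hs.1, neg_abs_le r], by linarith [hs.2, le_abs_self r]⟩
  simp only [heval, Q]
  push_cast
  rw [add_sub_add_left_eq_sub, ← Finset.sum_sub_distrib, Finset.sum_mul]
  refine (Finset.abs_sum_le_sum_abs _ _).trans (Finset.sum_le_sum fun j _ => ?_)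
  have hj := hfa j m
  rw [zpow_neg, zpow_natCast, ← inv_pow, ← one_div] at hj
  rw [← sub_mul, abs_mul, abs_pow, mul_comm]
  gcongr
end

section
/- Every finite Bayesian game in which all prior probabilities p(t) and all utility values u_i(t,a) are computable reals has a Nash equilibrium σ in behavioral strategies in which every probability σ_i(t_i)(a) is a computable real. -/
open Finset

/-- A probability distribution on a finite set: nonnegative weights summing to 1. -/
def IsDist {S : Type*} [Fintype S] (μ : S → ℝ) : Prop :=
  (∀ s, 0 ≤ μ s) ∧ ∑ s, μ s = 1

/-- A behavioral strategy for player `i`: a distribution on actions for each type. -/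
def IsBehavioral {T A : Type*} [Fintype A] (σ : T → A → ℝ) : Prop :=
  ∀ t, IsDist (σ t)

/-- The ex ante expected utility of player `i` in a finite Bayesian game under
the behavioral-strategy profile `σ`. -/
noncomputable def bayesExpUtil {m : ℕ} {T A : Fin m → Type*}
    [∀ i, Fintype (T i)] [∀ i, Fintype (A i)]
    (p : (∀ i, T i) → ℝ)
    (u : Fin m → (∀ i, T i) → (∀ i, A i) → ℝ)
    (σ : ∀ i, T i → A i → ℝ) (i : Fin m) : ℝ :=
  ∑ t : ∀ j, T j, p t * ∑ a : ∀ j, A j, (∏ j, σ j (t j) (a j)) * u i t a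

theorem Computable.nat_find {α : Type*} [Primcodable α] {p : α → ℕ → Prop}
    [∀ a, DecidablePred (p a)] (hp : Computable₂ fun a n => decide (p a n))
    (h : ∀ a, ∃ n, p a n) : Computable fun a => Nat.find (h a) := by
  refine (Partrec.rfind hp.partrec₂).of_eq_tot fun a => ?_
  rw [Nat.mem_rfind]
  refine ⟨?_, fun {m} hm => ?_⟩
  · simpa using Nat.find_spec (h a)
  · simpa using Nat.find_min (h a) hm

namespace Computable

variable {α : Type*} [Primcodable α] {f g : α → ℕ}

theorem nat_add (hf : Computable f) (hg : Computable g) : Computable fun x => f x + g x :=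
  Computable₂.comp (f := fun a b : ℕ => a + b) Primrec.nat_add.to_comp hf hg

theorem nat_mul (hf : Computable f) (hg : Computable g) : Computable fun x => f x * g x :=
  Computable₂.comp (f := fun a b : ℕ => a * b) Primrec.nat_mul.to_comp hf hg

theorem nat_sub (hf : Computable f) (hg : Computable g) : Computable fun x => f x - g x :=
  Computable₂.comp (f := fun a b : ℕ => a - b) Primrec.nat_sub.to_comp hf hg

theorem decide_nat_eq (hf : Computable f) (hg : Computable g) :
    Computable fun x => decide (f x = g x) :=
  Computable₂.comp (f := fun a b : ℕ => decide (a = b)) (Primrec.eq (α := ℕ)).decide.to_comp hf hg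

theorem decide_nat_le (hf : Computable f) (hg : Computable g) :
    Computable fun x => decide (f x ≤ g x) :=
  Computable₂.comp (f := fun a b : ℕ => decide (a ≤ b)) Primrec.nat_le.decide.to_comp hf hg

end Computable

theorem PrimrecPred.unpair_coprime :
    PrimrecPred fun m : ℕ => 0 < m.unpair.2 ∧ Nat.Coprime m.unpair.1 m.unpair.2 := by
  have hfst : Primrec fun m : ℕ => m.unpair.1 := Primrec.fst.comp Primrec.unpair
  have hsnd : Primrec fun m : ℕ => m.unpair.2 := Primrec.snd.comp Primrec.unpair
  have hR : PrimrecRel fun k y : ℕ => y.unpair.1 % k = 0 → y.unpair.2 % k = 0 → k ≤ 1 := by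
    have h1 : PrimrecRel fun k y : ℕ => y.unpair.1 % k = 0 :=
      Primrec.eq.comp (Primrec.nat_mod.comp (hfst.comp Primrec.snd) Primrec.fst) (Primrec.const 0)
    have h2 : PrimrecRel fun k y : ℕ => y.unpair.2 % k = 0 :=
      Primrec.eq.comp (Primrec.nat_mod.comp (hsnd.comp Primrec.snd) Primrec.fst) (Primrec.const 0)
    have h3 : PrimrecRel fun k _ : ℕ => k ≤ 1 :=
      Primrec.nat_le.comp Primrec.fst (Primrec.const 1)
    refine ((h1.not.or h2.not).or h3).of_eq fun k => ?_
    tauto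
  have hpos : PrimrecPred fun m : ℕ => 0 < m.unpair.2 :=
    Primrec.nat_lt.comp (Primrec.const 0) hsnd
  have hall := hR.forall_lt.comp (Primrec.succ.comp hsnd) Primrec.id
  refine (hpos.and hall).of_eq fun x =>
    and_congr_right fun hx => ⟨fun h => ?_, fun h k _ h1 h2 => ?_⟩
  · have hle := h (Nat.gcd x.unpair.1 x.unpair.2) (Nat.lt_succ_of_le (Nat.gcd_le_right _ hx))
      (Nat.mod_eq_zero_of_dvd (Nat.gcd_dvd_left _ _))
      (Nat.mod_eq_zero_of_dvd (Nat.gcd_dvd_right _ _))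
    have := Nat.gcd_pos_of_pos_right x.unpair.1 hx
    unfold Nat.Coprime
    omega
  · exact (Nat.eq_one_of_dvd_coprimes h (Nat.dvd_of_mod_eq_zero h1)
      (Nat.dvd_of_mod_eq_zero h2)).le

namespace Rat

/-- The code of a rational number as the pair of the code of its numerator and its denominator. -/
def pairCode (q : ℚ) : ℕ := Nat.pair (Equiv.intEquivNat q.num) q.den

theorem encode_eq_pairCode (q : ℚ) :
    @Encodable.encode ℚ Rat.instEncodable q = pairCode q := rfl

theorem intEquivNat_ofNat (m : ℕ) : Equiv.intEquivNat (Int.ofNat m) = 2 * m := rfl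

theorem intEquivNat_negSucc (m : ℕ) : Equiv.intEquivNat (Int.negSucc m) = 2 * m + 1 := rfl

theorem natAbs_intEquivNat_symm (a : ℕ) :
    (Equiv.intEquivNat.symm a).natAbs = a.div2 + (Bool.toNat a.bodd) := by
  obtain ⟨z, rfl⟩ := Equiv.intEquivNat.surjective a
  rw [Equiv.symm_apply_apply]
  rcases z with m | m
  · rw [intEquivNat_ofNat]
    simp [Nat.div2_val]
  · rw [intEquivNat_negSucc]
    simp [Nat.div2_val]

theorem exists_pairCode_ofNat :
    ∃ D : ℕ → Set.range pairCode, StrictMono D ∧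
      ∀ n, pairCode (Denumerable.ofNat ℚ n) = D n := by
  classical
  let := @Encodable.decidableRangeEncode ℚ Rat.instEncodable
  let : Infinite (Set.range (@Encodable.encode ℚ Rat.instEncodable)) :=
    Infinite.of_injective _
      (Equiv.ofInjective _ (@Encodable.encode_injective ℚ Rat.instEncodable)).injective
  refine ⟨Nat.Subtype.ofNat (Set.range (@Encodable.encode ℚ Rat.instEncodable)),
    strictMono_nat_of_lt_succ fun n => Nat.Subtype.lt_succ_self _, fun n => ?_⟩
  let := Nat.Subtype.denumerable (Set.range (@Encodable.encode ℚ Rat.instEncodable))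
  have h : Denumerable.ofNat ℚ n = (@Encodable.equivRangeEncode ℚ Rat.instEncodable).symm
      (Nat.Subtype.ofNat (Set.range (@Encodable.encode ℚ Rat.instEncodable)) n) := by
    refine (Denumerable.ofEquiv_ofNat (Set.range (@Encodable.encode ℚ Rat.instEncodable))
      (@Encodable.equivRangeEncode ℚ Rat.instEncodable) n).trans ?_
    congr 1
  rw [h, ← encode_eq_pairCode]
  exact congrArg Subtype.val ((@Encodable.equivRangeEncode ℚ Rat.instEncodable).apply_symm_apply _)

theorem mem_range_pairCode (m : ℕ) : m ∈ Set.range pairCode ↔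
    0 < m.unpair.2 ∧ Nat.Coprime (m.unpair.1.div2 + Bool.toNat m.unpair.1.bodd) m.unpair.2 := by
  rw [← natAbs_intEquivNat_symm]
  constructor
  · rintro ⟨q, rfl⟩
    simpa [pairCode] using And.intro q.pos q.reduced
  · rintro ⟨h1, h2⟩
    exact ⟨⟨Equiv.intEquivNat.symm m.unpair.1, m.unpair.2, h1.ne', h2⟩, by simp [pairCode]⟩

theorem primrecPred_mem_range_pairCode : PrimrecPred (· ∈ Set.range pairCode) := by
  have h1 : Primrec fun m : ℕ => m.unpair.1 := Primrec.fst.comp Primrec.unpair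
  have h2 : Primrec fun m : ℕ => m.unpair.2 := Primrec.snd.comp Primrec.unpair
  have h3 : Primrec fun m : ℕ => m.unpair.1.div2 + Bool.toNat m.unpair.1.bodd :=
    Primrec.nat_add.comp (Primrec.nat_div2.comp h1)
      ((Primrec.dom_bool Bool.toNat).comp (Primrec.nat_bodd.comp h1))
  exact (PrimrecPred.unpair_coprime.comp (Primrec₂.natPair.comp h3 h2)).of_eq fun m => by
    rw [mem_range_pairCode, Nat.unpair_pair]

theorem computable_pairCode_ofNat :
    Computable fun n => pairCode (Denumerable.ofNat ℚ n) := by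
  classical
  obtain ⟨D, hD, hDeq⟩ := exists_pairCode_ofNat
  have hD' : StrictMono fun n => pairCode (Denumerable.ofNat ℚ n) := fun a b hab => by
    simpa only [hDeq] using Subtype.coe_lt_coe.2 (hD hab)
  have hex : ∀ x, ∃ m, x < m ∧ m ∈ Set.range pairCode := fun x =>
    ⟨_, (Nat.lt_succ_self x).trans_le (hD'.le_apply (x := x + 1)), Set.mem_range_self _⟩
  have hpred : PrimrecRel fun x m : ℕ => x < m ∧ m ∈ Set.range pairCode :=
    Primrec.nat_lt.and (primrecPred_mem_range_pairCode.comp Primrec.snd)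
  have hnext : Computable fun x => Nat.find (hex x) :=
    Computable.nat_find (hpred.decide.to_comp) hex
  have hrec := Computable.nat_rec (Computable.id (α := ℕ))
    (Computable.const (pairCode (Denumerable.ofNat ℚ 0)))
    (h := fun _ y => Nat.find (hex y.2)) (hnext.comp (Computable.snd.comp Computable.snd))
  refine hrec.of_eq fun n => ?_
  induction n with
  | zero => rfl
  | succ n ih =>
    simp only [id] at ih ⊢
    rw [ih, Nat.find_eq_iff]
    refine ⟨⟨hD' n.lt_succ_self, Set.mem_range_self _⟩, ?_⟩
    rintro m hm ⟨hm1, q, rfl⟩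
    rw [← Denumerable.ofNat_encode q] at hm hm1
    have h1 := hD'.lt_iff_lt.1 hm
    have h2 := hD'.lt_iff_lt.1 hm1
    omega

/-- A rational-valued function presented by computable numerators and denominators. -/
def IsComputableFrac {α : Type*} [Primcodable α] (f : α → ℚ) : Prop :=
  ∃ a b c : α → ℕ, Computable a ∧ Computable b ∧ Computable c ∧
    ∀ x, f x = ((a x : ℚ) - b x) / (c x + 1)

theorem ofNat_surjective : Function.Surjective (Denumerable.ofNat ℚ) :=
  (Denumerable.eqv ℚ).symm.surjective

theorem isComputableFrac_ofNat : IsComputableFrac (Denumerable.ofNat ℚ) := by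
  have h := Computable.unpair.comp computable_pairCode_ofNat
  have h1 := Computable.fst.comp h
  have h2 := Computable.snd.comp h
  refine ⟨_, _, _, Computable.cond (Computable.nat_bodd.comp h1) (Computable.const 0)
      (Computable.nat_div2.comp h1),
    Computable.cond (Computable.nat_bodd.comp h1)
      (Computable.succ.comp (Computable.nat_div2.comp h1)) (Computable.const 0),
    Computable.pred.comp h2, fun n => ?_⟩
  generalize Denumerable.ofNat ℚ n = q
  have hden : ((q.den - 1 : ℕ) : ℚ) + 1 = q.den := by
    rw [Nat.cast_sub q.pos]
    simp
  simp only [pairCode, Nat.unpair_pair, Nat.pred_eq_sub_one, hden]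
  conv_lhs => rw [← Rat.num_div_den q]
  congr 1
  generalize q.num = z
  rcases z with m | m
  · rw [intEquivNat_ofNat]
    simp [Nat.div2_val]
  · have h : (2 * m + 1) / 2 = m := by omega
    rw [intEquivNat_negSucc]
    simp [Nat.div2_val, Int.negSucc_eq]

theorem IsComputableFrac.computable {α : Type*} [Primcodable α] {f : α → ℚ}
    (hf : IsComputableFrac f) : Computable f := by
  obtain ⟨a, b, c, ha, hb, hc, h⟩ := hf
  obtain ⟨a', b', c', ha', hb', hc', h'⟩ := isComputableFrac_ofNat
  have key : ∀ x n, Denumerable.ofNat ℚ n = f x ↔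
      a x * (c' n + 1) + b' n * (c x + 1) = a' n * (c x + 1) + b x * (c' n + 1) := by
    intro x n
    rw [h, h', div_eq_div_iff (by positivity) (by positivity), ← Nat.cast_inj (R := ℚ)]
    push_cast
    constructor <;> intro h <;> linarith
  have hex : ∀ x, ∃ n, a x * (c' n + 1) + b' n * (c x + 1)
      = a' n * (c x + 1) + b x * (c' n + 1) := fun x =>
    (ofNat_surjective (f x)).imp fun n hn => (key x n).1 hn
  have mc : Computable fun y : α × ℕ => c y.1 + 1 :=
    (hc.comp Computable.fst).nat_add (Computable.const 1)
  have mc' : Computable fun y : α × ℕ => c' y.2 + 1 :=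
    (hc'.comp Computable.snd).nat_add (Computable.const 1)
  have hdec : Computable₂ fun x n => decide (a x * (c' n + 1) + b' n * (c x + 1)
      = a' n * (c x + 1) + b x * (c' n + 1)) :=
    Computable.decide_nat_eq
      (((ha.comp Computable.fst).nat_mul mc').nat_add ((hb'.comp Computable.snd).nat_mul mc))
      (((ha'.comp Computable.snd).nat_mul mc).nat_add ((hb.comp Computable.fst).nat_mul mc'))
  exact ((Computable.ofNat ℚ).comp (Computable.nat_find hdec hex)).of_eq fun x =>
    (key x _).2 (Nat.find_spec (hex x))

end Rat

theorem Computable.decide_and {α : Type*} [Primcodable α] {p q : α → Prop}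
    [DecidablePred p] [DecidablePred q] (hp : Computable fun x => decide (p x))
    (hq : Computable fun x => decide (q x)) : Computable fun x => decide (p x ∧ q x) :=
  (Computable₂.comp (f := and) Primrec.and.to_comp hp hq).of_eq fun x => by simp

namespace Rat.IsComputableFrac

variable {α β : Type*} [Primcodable α] [Primcodable β] {f g : α → ℚ}

theorem of_computable (hf : Computable f) : IsComputableFrac f := by
  obtain ⟨a, b, c, ha, hb, hc, h⟩ := isComputableFrac_ofNat
  have he := Computable.encode_iff.2 hf
  refine ⟨_, _, _, ha.comp he, hb.comp he, hc.comp he, fun x => ?_⟩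
  rw [← h]
  exact (Denumerable.ofNat_encode (α := ℚ) (f x)).symm

theorem comp {e : β → α} (hf : IsComputableFrac f) (he : Computable e) :
    IsComputableFrac fun x => f (e x) := by
  obtain ⟨a, b, c, ha, hb, hc, h⟩ := hf
  exact ⟨_, _, _, ha.comp he, hb.comp he, hc.comp he, fun x => h (e x)⟩

theorem const (q : ℚ) : IsComputableFrac fun _ : α => q :=
  of_computable (Computable.const q)

theorem add (hf : IsComputableFrac f) (hg : IsComputableFrac g) :
    IsComputableFrac fun x => f x + g x := by
  obtain ⟨a, b, c, ha, hb, hc, h⟩ := hf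
  obtain ⟨a', b', c', ha', hb', hc', h'⟩ := hg
  have h1 := Computable.const (α := α) 1
  refine ⟨_, _, _, (ha.nat_mul (hc'.nat_add h1)).nat_add (ha'.nat_mul (hc.nat_add h1)),
    (hb.nat_mul (hc'.nat_add h1)).nat_add (hb'.nat_mul (hc.nat_add h1)),
    ((hc.nat_mul hc').nat_add hc).nat_add hc', fun x => ?_⟩
  beta_reduce
  rw [h, h', div_add_div _ _ (by positivity) (by positivity)]
  push_cast
  congr 1 <;> ring

theorem mul (hf : IsComputableFrac f) (hg : IsComputableFrac g) :
    IsComputableFrac fun x => f x * g x := by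
  obtain ⟨a, b, c, ha, hb, hc, h⟩ := hf
  obtain ⟨a', b', c', ha', hb', hc', h'⟩ := hg
  refine ⟨_, _, _, (ha.nat_mul ha').nat_add (hb.nat_mul hb'),
    (ha.nat_mul hb').nat_add (hb.nat_mul ha'),
    ((hc.nat_mul hc').nat_add hc).nat_add hc', fun x => ?_⟩
  beta_reduce
  rw [h, h', div_mul_div_comm]
  push_cast
  congr 1 <;> ring

theorem neg (hf : IsComputableFrac f) : IsComputableFrac fun x => - f x := by
  simpa using (const (-1)).mul hf

theorem inv (hf : IsComputableFrac f) : IsComputableFrac fun x => (f x)⁻¹ := by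
  obtain ⟨a, b, c, ha, hb, hc, h⟩ := hf
  have h1 := Computable.const (α := α) 1
  have hd := (ha.nat_sub hb).nat_add (hb.nat_sub ha)
  refine ⟨_, _, _, (hc.nat_add h1).nat_mul ha, (hc.nat_add h1).nat_mul hb,
    (hd.nat_mul hd).nat_sub h1, fun x => ?_⟩
  beta_reduce
  rw [h]
  rcases eq_or_ne (a x) (b x) with hab | hab
  · simp [hab]
  · set d := a x - b x + (b x - a x) with hd
    have hd0 : 1 ≤ d * d := Nat.mul_pos (by omega) (by omega)
    have hd2 : (d : ℚ) * d = ((a x : ℚ) - b x) * (a x - b x) := by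
      rcases le_total (a x) (b x) with hle | hle
      · have : d = b x - a x := by omega
        rw [this, Nat.cast_sub hle]
        ring
      · have : d = a x - b x := by omega
        rw [this, Nat.cast_sub hle]
    have hne : (a x : ℚ) - b x ≠ 0 := sub_ne_zero.2 (by exact_mod_cast hab)
    push_cast [Nat.cast_sub hd0]
    rw [hd2, sub_add_cancel]
    field_simp

theorem pow (hf : IsComputableFrac f) (n : ℕ) : IsComputableFrac fun x => f x ^ n := by
  induction n with
  | zero => simpa using const 1
  | succ n ih => simpa only [pow_succ] using ih.mul hf

theorem sum {ι : Type*} (s : Finset ι) {F : ι → α → ℚ} (hF : ∀ i, IsComputableFrac (F i)) :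
    IsComputableFrac fun x => ∑ i ∈ s, F i x := by
  classical
  induction s using Finset.induction_on with
  | empty => simpa using const 0
  | insert i s hi ih => simpa only [Finset.sum_insert hi] using (hF i).add ih

theorem half_pow {e : α → ℕ} (he : Computable e) :
    IsComputableFrac fun x => (1 / 2 : ℚ) ^ e x := by
  have hp : Computable fun x => 2 ^ e x :=
    Computable₂.comp (f := fun a b : ℕ => a ^ b) (Primrec₂.unpaired'.1 Nat.Primrec.pow).to_comp
      (Computable.const 2) he
  refine ⟨_, _, _, Computable.const 1, Computable.const 0, hp.nat_sub (Computable.const 1),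
    fun x => ?_⟩
  rw [Nat.cast_sub Nat.one_le_two_pow]
  simp

theorem decide_le (hf : IsComputableFrac f) (hg : IsComputableFrac g) :
    Computable fun x => decide (f x ≤ g x) := by
  obtain ⟨a, b, c, ha, hb, hc, h⟩ := hf.add hg.neg
  refine (Computable.decide_nat_le ha hb).of_eq fun x => ?_
  have hx : f x + -g x = _ := h x
  congr 1
  rw [← sub_nonpos (a := f x), sub_eq_add_neg, hx, div_le_iff₀ (by positivity)]
  simp

end Rat.IsComputableFrac

namespace ComputableReal

open Rat

variable {x y : ℝ}

theorem exists_isComputableFrac (hx : ComputableReal x) :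
    ∃ f : ℕ → ℚ, IsComputableFrac f ∧ ∀ n, |x - f n| ≤ (1 / 2 : ℝ) ^ n := by
  obtain ⟨f, hf, h⟩ := hx
  exact ⟨f, .of_computable hf, fun n => by simpa using h n⟩

theorem of_bound {f : ℕ → ℚ} (hf : IsComputableFrac f) (C : ℝ)
    (h : ∀ n, |x - f n| ≤ C * (1 / 2 : ℝ) ^ n) : ComputableReal x := by
  obtain ⟨k, hk⟩ := pow_unbounded_of_one_lt C one_lt_two
  refine ⟨fun n => f (n + k),
    (hf.comp (Computable.id.nat_add (Computable.const k))).computable, fun n => (h _).trans ?_⟩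
  calc C * (1 / 2 : ℝ) ^ (n + k) ≤ 2 ^ k * (1 / 2 : ℝ) ^ (n + k) := by gcongr
    _ = 2 ^ (-(n : ℤ)) := by
      rw [pow_add, mul_left_comm, ← mul_pow]
      simp

theorem ratCast (q : ℚ) : ComputableReal q :=
  of_bound (.const q) 0 fun n => by simp

theorem add (hx : ComputableReal x) (hy : ComputableReal y) : ComputableReal (x + y) := by
  obtain ⟨f, hf, hfx⟩ := hx.exists_isComputableFrac
  obtain ⟨g, hg, hgy⟩ := hy.exists_isComputableFrac
  refine of_bound (hf.add hg) 2 fun n => ?_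
  push_cast
  calc |x + y - (f n + g n)| = |(x - f n) + (y - g n)| := by ring_nf
    _ ≤ |x - f n| + |y - g n| := abs_add_le _ _
    _ ≤ 2 * (1 / 2 : ℝ) ^ n := by linarith [hfx n, hgy n]

theorem neg (hx : ComputableReal x) : ComputableReal (-x) := by
  obtain ⟨f, hf, hfx⟩ := hx.exists_isComputableFrac
  refine of_bound hf.neg 1 fun n => ?_
  push_cast
  rw [← neg_sub', abs_neg, one_mul]
  exact hfx n

theorem mul (hx : ComputableReal x) (hy : ComputableReal y) : ComputableReal (x * y) := by
  obtain ⟨f, hf, hfx⟩ := hx.exists_isComputableFrac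
  obtain ⟨g, hg, hgy⟩ := hy.exists_isComputableFrac
  refine of_bound (hf.mul hg) (|x| + (|y| + 1)) fun n => ?_
  have hgn : |(g n : ℝ)| ≤ |y| + 1 := by
    have h1 : |(g n : ℝ)| ≤ |y| + |y - g n| := by
      simpa using abs_sub y (y - g n)
    have h2 : (1 / 2 : ℝ) ^ n ≤ 1 := pow_le_one₀ (by norm_num) (by norm_num)
    linarith [hgy n]
  push_cast
  calc |x * y - f n * g n| = |x * (y - g n) + g n * (x - f n)| := by ring_nf
    _ ≤ |x| * |y - g n| + |(g n : ℝ)| * |x - f n| := by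
      simpa only [abs_mul] using abs_add_le (x * (y - g n)) (g n * (x - f n))
    _ ≤ |x| * (1 / 2 : ℝ) ^ n + (|y| + 1) * (1 / 2 : ℝ) ^ n := by
      gcongr
      · exact hgy n
      · exact hfx n
    _ = _ := by ring

theorem inv (hx : ComputableReal x) : ComputableReal x⁻¹ := by
  rcases eq_or_ne x 0 with rfl | h0
  · simpa using ratCast 0
  obtain ⟨f, hf, hfx⟩ := hx.exists_isComputableFrac
  have hpos : 0 < |x| := abs_pos.2 h0
  obtain ⟨k, hk⟩ := exists_pow_lt_of_lt_one (half_pos hpos) (show (1 / 2 : ℝ) < 1 by norm_num)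
  have hk' : ∀ n, (1 / 2 : ℝ) ^ (n + k) ≤ (1 / 2 : ℝ) ^ n := fun n =>
    pow_le_pow_of_le_one (by norm_num) (by norm_num) (Nat.le_add_right _ _)
  refine of_bound (hf.comp (Computable.id.nat_add (Computable.const k))).inv
    (2 / (|x| * |x|)) fun n => ?_
  simp only [id]
  have h1 : |x - f (n + k)| ≤ |x| / 2 := by
    refine ((hfx _).trans ?_).trans hk.le
    exact pow_le_pow_of_le_one (by norm_num) (by norm_num) (Nat.le_add_left _ _)
  have h2 : |x| / 2 ≤ |(f (n + k) : ℝ)| := by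
    have := abs_sub_abs_le_abs_sub x (f (n + k))
    linarith
  have h3 : (f (n + k) : ℝ) ≠ 0 := abs_pos.1 ((half_pos hpos).trans_le h2)
  push_cast
  rw [inv_sub_inv h0 h3, abs_div, abs_mul, abs_sub_comm]
  calc |x - f (n + k)| / (|x| * |(f (n + k) : ℝ)|)
      ≤ (1 / 2 : ℝ) ^ n / (|x| * (|x| / 2)) := by
        gcongr
        exact (hfx _).trans (hk' n)
    _ = _ := by field_simp

end ComputableReal

/-- The field of computable real numbers. -/
def computableReals : Subfield ℝ where
  carrier := {x | ComputableReal x}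
  mul_mem' := ComputableReal.mul
  one_mem' := by simpa using ComputableReal.ratCast 1
  add_mem' := ComputableReal.add
  zero_mem' := by simpa using ComputableReal.ratCast 0
  neg_mem' := ComputableReal.neg
  inv_mem' _ := ComputableReal.inv

open Polynomial in
theorem ComputableReal.of_isRoot {P : ℝ[X]} (hP : P ≠ 0) (hc : ∀ i, ComputableReal (P.coeff i))
    {x : ℝ} (hx : P.IsRoot x) : ComputableReal x := by
  classical
  obtain ⟨h, hPh, hh⟩ := exists_eq_pow_rootMultiplicity_mul_and_not_dvd P hP x
  set m := P.rootMultiplicity x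
  have hm : 0 < m := (rootMultiplicity_pos hP).2 hx
  have hhx : h.eval x ≠ 0 := fun h0 => hh (dvd_iff_isRoot.2 h0)
  obtain ⟨δ, hδ, hball⟩ := Metric.eventually_nhds_iff.1
    ((h.continuous.abs.tendsto x).eventually_const_lt (half_lt_self (abs_pos.2 hhx)))
  set c := |h.eval x| / 2
  have hcpos : 0 < c := half_pos (abs_pos.2 hhx)
  obtain ⟨a, ha1, ha2⟩ := exists_rat_btwn (show x - min δ 1 < x by simp [hδ])
  obtain ⟨b, hb1, hb2⟩ := exists_rat_btwn (show x < x + min δ 1 by simp [hδ])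
  have hnear : ∀ q : ℚ, a ≤ q → q ≤ b → |(q : ℝ) - x| < min δ 1 := fun q h1 h2 => by
    have h1' : (a : ℝ) ≤ q := by exact_mod_cast h1
    have h2' : (q : ℝ) ≤ b := by exact_mod_cast h2
    rw [abs_lt]
    constructor <;> linarith
  choose F hF hFb using fun i => (hc i).exists_isComputableFrac
  set N := P.natDegree + 1
  let G : ℕ → ℚ → ℚ := fun n q => ∑ i ∈ range N, F i n * q ^ i
  set M : ℝ := ∑ i ∈ range N, (|x| + 1) ^ i
  have hG : ∀ n (q : ℚ), a ≤ q → q ≤ b → |P.eval (q : ℝ) - G n q| ≤ M * (1 / 2 : ℝ) ^ n := by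
    intro n q h1 h2
    have hq : |(q : ℝ)| ≤ |x| + 1 := by
      have h3 := (hnear q h1 h2).trans_le (min_le_right _ _)
      have h4 := abs_sub_abs_le_abs_sub (q : ℝ) x
      linarith
    rw [eval_eq_sum_range, Rat.cast_sum, ← Finset.sum_sub_distrib, Finset.sum_mul]
    refine (Finset.abs_sum_le_sum_abs _ _).trans (Finset.sum_le_sum fun i _ => ?_)
    push_cast
    rw [← sub_mul, abs_mul, abs_pow, mul_comm]
    gcongr
    exact hFb i n
  obtain ⟨M', hM'⟩ := exists_nat_ge (M + 1)
  let Q : ℕ → ℕ → Prop := fun n k =>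
    (a ≤ Denumerable.ofNat ℚ k ∧ Denumerable.ofNat ℚ k ≤ b) ∧
    (G (m * n) (Denumerable.ofNat ℚ k) ≤ M' * (1 / 2 : ℚ) ^ (m * n) ∧
      -(M' * (1 / 2 : ℚ) ^ (m * n)) ≤ G (m * n) (Denumerable.ofNat ℚ k))
  have hcast : ∀ j, ((M' * (1 / 2 : ℚ) ^ j : ℚ) : ℝ) = M' * (1 / 2 : ℝ) ^ j := fun j => by
    push_cast
    rfl
  have hex : ∀ n, ∃ k, Q n k := by
    intro n
    have hev : ∀ᶠ y in nhds x, |P.eval y| < (1 / 2 : ℝ) ^ (m * n) ∧ (a : ℝ) < y ∧ y < b := by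
      refine Filter.Eventually.and ?_ ((lt_mem_nhds ha2).and (gt_mem_nhds hb1))
      refine (P.continuous.abs.tendsto x).eventually_lt_const ?_
      rw [hx.eq_zero, abs_zero]
      positivity
    obtain ⟨l, r, ⟨hl, hr⟩, hlr⟩ := mem_nhds_iff_exists_Ioo_subset.1 hev
    obtain ⟨q, hq1, hq2⟩ := exists_rat_btwn (hl.trans hr)
    obtain ⟨hq, hqa, hqb⟩ := hlr ⟨hq1, hq2⟩
    obtain ⟨k, rfl⟩ := Rat.ofNat_surjective q
    have hqa' : a ≤ Denumerable.ofNat ℚ k := by exact_mod_cast hqa.le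
    have hqb' : Denumerable.ofNat ℚ k ≤ b := by exact_mod_cast hqb.le
    have h1 := hG (m * n) _ hqa' hqb'
    have h2 : |(G (m * n) (Denumerable.ofNat ℚ k) : ℝ)| ≤ M' * (1 / 2 : ℝ) ^ (m * n) := by
      have h3 := abs_sub_abs_le_abs_sub (G (m * n) (Denumerable.ofNat ℚ k) : ℝ)
        (P.eval ((Denumerable.ofNat ℚ k : ℚ) : ℝ))
      rw [abs_sub_comm] at h3
      calc _ ≤ (M + 1) * (1 / 2 : ℝ) ^ (m * n) := by linarith
        _ ≤ _ := by gcongr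
    have h4 : |G (m * n) (Denumerable.ofNat ℚ k)| ≤ M' * (1 / 2 : ℚ) ^ (m * n) := by
      rw [← Rat.cast_le (K := ℝ), Rat.cast_abs, hcast]
      exact h2
    exact ⟨k, ⟨hqa', hqb'⟩, (abs_le.1 h4).2, (abs_le.1 h4).1⟩
  have hofNat : Rat.IsComputableFrac fun z : ℕ × ℕ => Denumerable.ofNat ℚ z.2 :=
    Rat.isComputableFrac_ofNat.comp Computable.snd
  have hmn : Computable fun z : ℕ × ℕ => m * z.1 := (Computable.const m).nat_mul Computable.fst
  have hGc : Rat.IsComputableFrac fun z : ℕ × ℕ => G (m * z.1) (Denumerable.ofNat ℚ z.2) :=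
    Rat.IsComputableFrac.sum _ fun i => ((hF i).comp hmn).mul (hofNat.pow i)
  have hBc : Rat.IsComputableFrac fun z : ℕ × ℕ => (M' : ℚ) * (1 / 2 : ℚ) ^ (m * z.1) :=
    (Rat.IsComputableFrac.const _).mul (Rat.IsComputableFrac.half_pow hmn)
  have hQ : Computable fun z : ℕ × ℕ => decide (Q z.1 z.2) :=
    (((Rat.IsComputableFrac.const a).decide_le hofNat).decide_and
      (hofNat.decide_le (Rat.IsComputableFrac.const b))).decide_and
      ((hGc.decide_le hBc).decide_and (hBc.neg.decide_le hGc))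
  obtain ⟨g, hg, hgQ⟩ : ∃ g : ℕ → ℕ, Computable g ∧ ∀ n, Q n (g n) := by
    have : ∀ n, DecidablePred (Q n) := fun n k => inferInstance
    exact ⟨_, Computable.nat_find (p := Q) (hQ.of_eq fun z => by congr) hex,
      fun n => Nat.find_spec (hex n)⟩
  set C := (M' + M) / c
  have hM : 0 ≤ M := Finset.sum_nonneg fun i _ => by positivity
  have hC : 0 ≤ C := div_nonneg (add_nonneg (Nat.cast_nonneg _) hM) hcpos.le
  refine of_bound (Rat.isComputableFrac_ofNat.comp hg) (max 1 C) fun n => ?_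
  obtain ⟨⟨h1, h2⟩, h3, h4⟩ := hgQ n
  set q := Denumerable.ofNat ℚ (g n)
  have h5 : |(G (m * n) q : ℝ)| ≤ M' * (1 / 2 : ℝ) ^ (m * n) := by
    rw [← hcast, ← Rat.cast_abs, Rat.cast_le]
    exact abs_le.2 ⟨h4, h3⟩
  have h6 : |P.eval (q : ℝ)| ≤ (M' + M) * (1 / 2 : ℝ) ^ (m * n) := by
    have h7 := abs_sub_abs_le_abs_sub (P.eval (q : ℝ)) (G (m * n) q : ℝ)
    linarith [hG (m * n) q h1 h2]
  have h7 : c < |h.eval (q : ℝ)| := hball ((hnear q h1 h2).trans_le (min_le_left _ _))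
  have h8 : |(q : ℝ) - x| ^ m * c ≤ (M' + M) * (1 / 2 : ℝ) ^ (m * n) := by
    refine le_trans ?_ h6
    have : P.eval (q : ℝ) = ((q : ℝ) - x) ^ m * h.eval (q : ℝ) := by
      conv_lhs => rw [hPh]
      rw [eval_mul, eval_pow, eval_sub, eval_X, eval_C]
    rw [this, abs_mul, abs_pow]
    gcongr
  have h9 : |(q : ℝ) - x| ^ m ≤ (max 1 C * (1 / 2 : ℝ) ^ n) ^ m := by
    calc |(q : ℝ) - x| ^ m ≤ C * (1 / 2 : ℝ) ^ (m * n) := by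
          rw [div_mul_eq_mul_div, le_div_iff₀ hcpos]
          exact h8
      _ ≤ (max 1 C) ^ m * (1 / 2 : ℝ) ^ (m * n) := by
          gcongr
          exact (le_max_right 1 C).trans (le_self_pow₀ (le_max_left _ _) hm.ne')
      _ = _ := by rw [mul_pow, ← pow_mul, mul_comm m n]
  rw [abs_sub_comm]
  exact le_of_pow_le_pow_left₀ hm.ne' (by positivity) h9

section Transfer

open Polynomial IntermediateField Filter Topology

/-- A ring homomorphism extends to a simple extension once a value for the generator is chosen
that satisfies exactly the same polynomial equations. -/
theorem IntermediateField.exists_ringHom_adjoin_simple {L E F : Type*} [Field L] [Field E]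
    [Field F] [Algebra L E] (a : E) (ψ : L →+* F) (b : F)
    (h : ∀ p : L[X], aeval a p = 0 ↔ p.eval₂ ψ b = 0) :
    ∃ φ : L⟮a⟯ →+* F, (∀ z, φ (algebraMap L L⟮a⟯ z) = ψ z) ∧ φ (AdjoinSimple.gen L a) = b := by
  let := ψ.toAlgebra
  have h' : ∀ p : L[X], aeval a p = 0 ↔ aeval b p = 0 := h
  by_cases ha : IsIntegral L a
  · have hb : b ∈ (minpoly L a).aroots F :=
      (mem_aroots).2 ⟨minpoly.ne_zero ha, (h' _).1 (minpoly.aeval L a)⟩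
    let φ : L⟮a⟯ →ₐ[L] F := (algHomAdjoinIntegralEquiv L ha).symm ⟨b, hb⟩
    exact ⟨φ, fun z => φ.commutes z, algHomAdjoinIntegralEquiv_symm_apply_gen L ha ⟨b, hb⟩⟩
  · have ha' : Transcendental L a := fun h => ha h.isIntegral
    have hb : Function.Injective (aeval b : L[X] →ₐ[L] F) :=
      (injective_iff_map_eq_zero _).2 fun p hp =>
        (injective_iff_map_eq_zero _).1 (transcendental_iff_injective.1 ha') p ((h' p).2 hp)
    have hb' := nonZeroDivisors_le_comap_nonZeroDivisors_of_injective _ hb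
    let φ := (RatFunc.liftAlgHom (aeval b : L[X] →ₐ[L] F) hb').comp
      (RatFunc.algEquivOfTranscendental a ha').symm.toAlgHom
    refine ⟨φ, fun z => AlgHom.commutes φ z, ?_⟩
    change RatFunc.liftAlgHom _ hb' ((RatFunc.algEquivOfTranscendental a ha').symm _) = b
    rw [RatFunc.algEquivOfTranscendental_symm_gen, ← RatFunc.algebraMap_X,
      RatFunc.liftAlgHom_apply]
    simp

/-- The germ `z` is represented by a sequence in `K` converging to `r` along `l`. -/
def Filter.Germ.ApproxIn (K : Subfield ℝ) {l : Filter ℕ} (z : Germ l ℝ) (r : ℝ) : Prop :=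
  ∃ f : ℕ → ℝ, (∀ n, f n ∈ K) ∧ Tendsto f l (𝓝 r) ∧ z = f

namespace Filter.Germ.ApproxIn

variable {K : Subfield ℝ} {l : Ultrafilter ℕ} {z w : Germ (l : Filter ℕ) ℝ} {r s : ℝ}

theorem add (hz : ApproxIn K z r) (hw : ApproxIn K w s) : ApproxIn K (z + w) (r + s) := by
  obtain ⟨f, hf, hfr, rfl⟩ := hz
  obtain ⟨g, hg, hgs, rfl⟩ := hw
  exact ⟨f + g, fun n => K.add_mem (hf n) (hg n), hfr.add hgs, rfl⟩

theorem mul (hz : ApproxIn K z r) (hw : ApproxIn K w s) : ApproxIn K (z * w) (r * s) := by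
  obtain ⟨f, hf, hfr, rfl⟩ := hz
  obtain ⟨g, hg, hgs, rfl⟩ := hw
  exact ⟨f * g, fun n => K.mul_mem (hf n) (hg n), hfr.mul hgs, rfl⟩

theorem inv (hz : ApproxIn K z r) (hr : r ≠ 0) : ApproxIn K z⁻¹ r⁻¹ := by
  obtain ⟨f, hf, hfr, rfl⟩ := hz
  exact ⟨f⁻¹, fun n => K.inv_mem (hf n), hfr.inv₀ hr, rfl⟩

theorem const (hr : r ∈ K) : ApproxIn K ((fun _ => r : ℕ → ℝ) : Germ (l : Filter ℕ) ℝ) r :=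
  ⟨_, fun _ => hr, tendsto_const_nhds, rfl⟩

theorem zero : ApproxIn K (0 : Germ (l : Filter ℕ) ℝ) 0 := const K.zero_mem

theorem eq_zero (hz : ApproxIn K z r) (h0 : z = 0) : r = 0 := by
  obtain ⟨f, -, hfr, rfl⟩ := hz
  have h : f =ᶠ[l] fun _ => 0 := Germ.coe_eq.1 h0
  exact tendsto_nhds_unique hfr (tendsto_const_nhds.congr' h.symm)

theorem eval₂ {L : IntermediateField K ℝ} {ψ : L →+* Germ (l : Filter ℕ) ℝ}
    (hψ : ∀ z, ApproxIn K (ψ z) z) {a : ℝ} (hz : ApproxIn K z a) (p : L[X]) :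
    ApproxIn K (p.eval₂ ψ z) (aeval a p) := by
  induction p using Polynomial.induction_on' with
  | add p q hp hq => simpa only [eval₂_add, map_add] using hp.add hq
  | monomial n c =>
    rw [eval₂_monomial, aeval_monomial]
    refine (hψ c).mul ?_
    induction n with
    | zero =>
      rw [pow_zero, pow_zero]
      exact const K.one_mem
    | succ n ih => simpa only [pow_succ] using ih.mul hz

end Filter.Germ.ApproxIn

/-- If the coefficients of polynomials over a relatively algebraically closed subfield `K` of `ℝ`
converge to those of `f`, then their roots in `K` accumulate at every simple root of `f`. -/
theorem exists_tendsto_isRoot {K : Subfield ℝ}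
    (hK : ∀ P : ℝ[X], P ≠ 0 → (∀ i, P.coeff i ∈ K) → ∀ x, P.IsRoot x → x ∈ K)
    {l : Filter ℕ} {f : ℝ[X]} {a : ℝ} (ha : f.IsRoot a) (ha' : f.derivative.eval a ≠ 0)
    {g : ℕ → ℝ[X]} (hgK : ∀ n i, (g n).coeff i ∈ K)
    (hg : ∀ y, Tendsto (fun n => (g n).eval y) l (𝓝 (f.eval y))) :
    ∃ b : ℕ → ℝ, (∀ n, b n ∈ K) ∧ Tendsto b l (𝓝 a) ∧ ∀ᶠ n in l, (g n).IsRoot (b n) := by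
  classical
  obtain ⟨h, rfl⟩ := dvd_iff_isRoot.2 ha
  have hha : h.eval a ≠ 0 := by simpa using ha'
  have hb : ∀ n, ∃ b ∈ K, ∀ y, g n ≠ 0 → (g n).IsRoot y → (g n).IsRoot b ∧ |b - a| ≤ |y - a| := by
    intro n
    rcases (g n).roots.toFinset.eq_empty_or_nonempty with h0 | h0
    · refine ⟨0, K.zero_mem, fun y h1 h2 => ?_⟩
      have : y ∈ (g n).roots.toFinset := by simpa [h1] using h2
      simp [h0] at this
    · obtain ⟨b, hb, hmin⟩ := Finset.exists_min_image _ (fun y => |y - a|) h0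
      have hb' : g n ≠ 0 ∧ (g n).IsRoot b := by simpa using hb
      refine ⟨b, hK _ hb'.1 (hgK n) _ hb'.2, fun y h1 h2 => ⟨hb'.2, hmin y (by simpa [h1] using h2)⟩⟩
  choose b hbK hb using hb
  have key : ∀ ε > 0, ∀ᶠ n in l, (g n).IsRoot (b n) ∧ |b n - a| < ε := by
    intro ε hε
    obtain ⟨δ, hδ, hball⟩ := Metric.eventually_nhds_iff.1
      (((h.continuous.mul continuous_const).tendsto a).eventually_const_lt
        (mul_self_pos.2 hha : (0 : ℝ) < (fun y => h.eval y * h.eval a) a))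
    set η := min ε δ / 2
    have hη : 0 < η := by positivity
    have hηε : η < min ε δ := half_lt_self (by positivity)
    have h1 : 0 < h.eval (a - η) * h.eval a :=
      hball (by simpa [Real.dist_eq, abs_of_pos hη] using hηε.trans_le (min_le_right _ _))
    have h2 : 0 < h.eval (a + η) * h.eval a :=
      hball (by simpa [Real.dist_eq, abs_of_pos hη] using hηε.trans_le (min_le_right _ _))
    have h3 : 0 < h.eval (a - η) * h.eval (a + η) := by
      have := mul_pos h1 h2
      have h4 : 0 < (h.eval (a - η) * h.eval (a + η)) * (h.eval a * h.eval a) := by linarith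
      exact pos_of_mul_pos_left h4 (mul_self_nonneg _)
    have h4 : ((X - C a) * h).eval (a - η) * ((X - C a) * h).eval (a + η) < 0 := by
      simp only [eval_mul, eval_sub, eval_X, eval_C]
      nlinarith [mul_pos (mul_pos hη hη) h3]
    filter_upwards [((hg (a - η)).mul (hg (a + η))).eventually_lt_const h4] with n hn
    have hn0 : g n ≠ 0 := by
      rintro h0
      simp [h0] at hn
    obtain ⟨y, ⟨hy1, hy2⟩, hy⟩ : ∃ y ∈ Set.Icc (a - η) (a + η), (g n).eval y = 0 := by
      have hle : a - η ≤ a + η := by linarith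
      rcases mul_neg_iff.1 hn with ⟨hp, hq⟩ | ⟨hp, hq⟩
      · exact intermediate_value_Icc' hle (g n).continuous.continuousOn ⟨hq.le, hp.le⟩
      · exact intermediate_value_Icc hle (g n).continuous.continuousOn ⟨hp.le, hq.le⟩
    obtain ⟨h5, h6⟩ := hb n y hn0 hy
    refine ⟨h5, h6.trans_lt (lt_of_le_of_lt ?_ (hηε.trans_le (min_le_left _ _)))⟩
    exact abs_le.2 ⟨by linarith, by linarith⟩
  exact ⟨b, hbK, Metric.tendsto_nhds.2 fun ε hε => (key ε hε).mono fun n hn => hn.2,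
    (key 1 one_pos).mono fun n hn => hn.1⟩

theorem Filter.Germ.ApproxIn.exists_root {K : Subfield ℝ}
    (hK : ∀ P : ℝ[X], P ≠ 0 → (∀ i, P.coeff i ∈ K) → ∀ x, P.IsRoot x → x ∈ K)
    {l : Ultrafilter ℕ} {L : IntermediateField K ℝ} {ψ : L →+* Germ (l : Filter ℕ) ℝ}
    (hψ : ∀ z, ApproxIn K (ψ z) z) {a : ℝ} (ha : IsIntegral L a) :
    ∃ b, ApproxIn K b a ∧ (minpoly L a).eval₂ ψ b = 0 := by
  set f := minpoly L a
  choose c hcK hc hcψ using fun i => hψ (f.coeff i)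
  let g : ℕ → ℝ[X] := fun n => ∑ i ∈ range (f.natDegree + 1), C (c i n) * X ^ i
  have hgeval : ∀ n y, (g n).eval y = ∑ i ∈ range (f.natDegree + 1), c i n * y ^ i := by
    intro n y
    simp [g, eval_finsetSum]
  have hfroot : (f.map (algebraMap L ℝ)).IsRoot a := by
    rw [IsRoot, eval_map_algebraMap]
    exact minpoly.aeval L a
  have hfder : (f.map (algebraMap L ℝ)).derivative.eval a ≠ 0 := by
    rw [derivative_map, eval_map_algebraMap]
    exact (minpoly.irreducible ha).separable.aeval_derivative_ne_zero (minpoly.aeval L a)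
  obtain ⟨b, hbK, hba, hb⟩ := exists_tendsto_isRoot hK (l := l) hfroot hfder (g := g)
    (fun n i => by
      simp only [g, finsetSum_coeff, coeff_C_mul, coeff_X_pow]
      refine sum_mem fun j _ => K.mul_mem (hcK j n) ?_
      split_ifs
      exacts [K.one_mem, K.zero_mem])
    (fun y => by
      simp only [hgeval]
      rw [eval_map_algebraMap, aeval_eq_sum_range]
      exact tendsto_finsetSum _ fun i _ => (hc i).mul_const _)
  refine ⟨b, ⟨b, hbK, hba, rfl⟩, ?_⟩
  rw [eval₂_eq_sum_range]
  simp only [hcψ]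
  have : ∑ i ∈ range (f.natDegree + 1), (c i : Germ (l : Filter ℕ) ℝ) * (b : Germ (l : Filter ℕ) ℝ) ^ i
      = ((∑ i ∈ range (f.natDegree + 1), c i * b ^ i : ℕ → ℝ) : Germ (l : Filter ℕ) ℝ) :=
    (map_sum (Germ.coeRingHom (l : Filter ℕ)) (fun i => c i * b ^ i) _).symm
  rw [this]
  refine Germ.coe_eq.2 (hb.mono fun n hn => ?_)
  simpa [hgeval] using hn.eq_zero

theorem Filter.Germ.ApproxIn.exists_extension {K : Subfield ℝ}
    (hK : ∀ P : ℝ[X], P ≠ 0 → (∀ i, P.coeff i ∈ K) → ∀ x, P.IsRoot x → x ∈ K)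
    {l : Ultrafilter ℕ} (hl : (l : Filter ℕ) ≤ atTop) {L : IntermediateField K ℝ}
    {ψ : L →+* Germ (l : Filter ℕ) ℝ}
    (hψ : ∀ z, ApproxIn K (ψ z) z) (a : ℝ) :
    ∃ φ : L⟮a⟯ →+* Germ (l : Filter ℕ) ℝ, (∀ z, φ (algebraMap L L⟮a⟯ z) = ψ z) ∧
      ∀ z, ApproxIn K (φ z) z := by
  obtain ⟨b, hba, hb⟩ : ∃ b, ApproxIn K b a ∧ ∀ p : L[X], aeval a p = 0 → p.eval₂ ψ b = 0 := by
    by_cases ha : IsIntegral L a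
    · obtain ⟨b, hba, hb⟩ := exists_root hK hψ ha
      refine ⟨b, hba, fun p hp => ?_⟩
      obtain ⟨q, rfl⟩ := minpoly.dvd L a hp
      rw [eval₂_mul, hb, zero_mul]
    · obtain ⟨u, -, -, hu⟩ := Real.exists_seq_rat_strictMono_tendsto a
      refine ⟨_, ⟨fun n => u n, fun n => SubfieldClass.ratCast_mem K (u n), hu.mono_left hl, rfl⟩,
        fun p hp => ?_⟩
      have : p = 0 := by
        by_contra h0
        exact ha (IsAlgebraic.isIntegral ⟨p, h0, hp⟩)
      rw [this, eval₂_zero]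
  obtain ⟨φ, hφ, hφa⟩ := exists_ringHom_adjoin_simple a ψ b
    fun p => ⟨hb p, fun h => (hba.eval₂ hψ p).eq_zero h⟩
  refine ⟨φ, hφ, fun ⟨z, hz⟩ => ?_⟩
  induction hz using adjoin_induction with
  | mem x hx =>
    obtain rfl : x = a := hx
    have : φ ⟨x, subset_adjoin L {x} rfl⟩ = b := hφa
    rw [this]
    exact hba
  | algebraMap x =>
    have : φ ⟨algebraMap L ℝ x, L⟮a⟯.algebraMap_mem x⟩ = ψ x := hφ x
    rw [this]
    exact hψ x
  | add x y hx hy ihx ihy =>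
    have := ihx.add ihy
    rwa [← map_add] at this
  | mul x y hx hy ihx ihy =>
    have := ihx.mul ihy
    rwa [← map_mul] at this
  | inv x hx ih =>
    rcases eq_or_ne x 0 with rfl | h0
    · have h : (⟨(0 : ℝ)⁻¹, L⟮a⟯.inv_mem hx⟩ : L⟮a⟯) = 0 := Subtype.ext inv_zero
      rw [h, map_zero]
      exact zero
    · have := ih.inv h0
      rwa [← map_inv₀] at this

/-- Finitely many polynomial equations and strict inequalities over a relatively algebraically
closed subfield of `ℝ` that are solvable in `ℝ` are solvable in the subfield. -/
theorem MvPolynomial.exists_mem_subfield {K : Subfield ℝ}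
    (hK : ∀ P : ℝ[X], P ≠ 0 → (∀ i, P.coeff i ∈ K) → ∀ x, P.IsRoot x → x ∈ K)
    {ι : Type*} [Fintype ι] (x : ι → ℝ) {S : Set (MvPolynomial ι K)} (hS : S.Finite) :
    ∃ y : ι → ℝ, (∀ i, y i ∈ K) ∧ ∀ P ∈ S,
      (aeval x P = 0 → aeval y P = 0) ∧ (0 < aeval x P → 0 < aeval y P) := by
  classical
  set l := hyperfilter ℕ
  have hl : (l : Filter ℕ) ≤ atTop := by
    rw [← Nat.cofinite_eq_atTop]
    exact hyperfilter_le_cofinite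
  let c : ℝ →+* Germ (l : Filter ℕ) ℝ := (Germ.coeRingHom (l : Filter ℕ)).comp (Pi.constRingHom ℕ ℝ)
  have hL : ∃ ψ : adjoin K ((univ.image x : Finset ℝ) : Set ℝ) →+* Germ (l : Filter ℕ) ℝ,
      (∀ z : K, ψ (algebraMap K _ z) = c z) ∧ ∀ z, Germ.ApproxIn K (ψ z) z := by
    refine induction_on_adjoin_finset (univ.image x) (fun L => ∃ ψ : L →+* Germ (l : Filter ℕ) ℝ,
      (∀ z : K, ψ (algebraMap K _ z) = c z) ∧ ∀ z, Germ.ApproxIn K (ψ z) z) ?_ ?_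
    · refine ⟨(c.comp K.subtype).comp (botEquiv K ℝ).toAlgHom.toRingHom, fun z => ?_, fun z => ?_⟩
      · simp
      · obtain ⟨z, rfl⟩ := (botEquiv K ℝ).symm.surjective z
        change Germ.ApproxIn K (c (botEquiv K ℝ ((botEquiv K ℝ).symm z))) _
        rw [AlgEquiv.apply_symm_apply]
        exact Germ.ApproxIn.const z.2
    · rintro L a - ⟨ψ, hψ1, hψ2⟩
      obtain ⟨φ, hφ1, hφ2⟩ := Germ.ApproxIn.exists_extension hK hl hψ2 a
      exact ⟨φ, fun z => (hφ1 (algebraMap K L z)).trans (hψ1 z), hφ2⟩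
  obtain ⟨ψ, hψ1, hψ2⟩ := hL
  have hx : ∀ i, x i ∈ adjoin K ((univ.image x : Finset ℝ) : Set ℝ) := fun i =>
    subset_adjoin K _ (by simp)
  choose v hvK hv hvψ using fun i => hψ2 ⟨x i, hx i⟩
  have key : ∀ P : MvPolynomial ι K, ψ (aeval (fun i => ⟨x i, hx i⟩) P) =
      ((fun n => aeval (fun i => v i n) P : ℕ → ℝ) : Germ (l : Filter ℕ) ℝ) := by
    intro P
    induction P using MvPolynomial.induction_on with
    | C z =>
      simp only [aeval_C, hψ1]
      rfl
    | add P Q hP hQ =>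
      simp only [map_add, hP, hQ]
      rfl
    | mul_X P i hP =>
      simp only [map_mul, hP, aeval_X, hvψ]
      rfl
  have hev : ∀ P ∈ S, ∀ᶠ n in (l : Filter ℕ), (aeval x P = 0 → aeval (fun i => v i n) P = 0) ∧
      (0 < aeval x P → 0 < aeval (fun i => v i n) P) := by
    intro P _
    refine Eventually.and ?_ ?_
    · by_cases h0 : aeval x P = 0
      · have h1 : aeval (fun i => (⟨x i, hx i⟩ : adjoin K _)) P = 0 := by
          apply Subtype.ext
          refine Eq.trans ?_ h0
          exact map_aeval _ (adjoin K ((univ.image x : Finset ℝ) : Set ℝ)).val.toRingHom P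
        have h2 := key P
        erw [h1] at h2
        rw [map_zero] at h2
        exact (Germ.coe_eq.1 h2.symm).mono fun n hn _ => hn
      · exact Eventually.of_forall fun n h => absurd h h0
    · by_cases h0 : 0 < aeval x P
      · have hcont : Continuous fun y : ι → ℝ => aeval y P := by
          simp only [aeval_def, eval₂_eq_eval_map]
          exact MvPolynomial.continuous_eval _
        exact (((hcont.tendsto x).comp (tendsto_pi_nhds.2 hv)).eventually_const_lt h0).mono
          fun n hn _ => hn
      · exact Eventually.of_forall fun n h => absurd h h0
  obtain ⟨n, hn⟩ := ((hS.eventually_all).2 hev).exists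
  exact ⟨fun i => v i n, fun i => hvK i n, hn⟩

end Transfer

section Brouwer

open MeasureTheory Metric
open scoped RealInnerProductSpace NNReal

/-- The nearest-point projection onto a closed convex set is nonexpansive. -/
theorem Convex.exists_nearest_point {E : Type*} [NormedAddCommGroup E] [InnerProductSpace ℝ E]
    [CompleteSpace E] {K : Set E} (hne : K.Nonempty) (hcl : IsClosed K) (hconv : Convex ℝ K) :
    ∃ π : E → E, (∀ x, π x ∈ K) ∧ LipschitzWith 1 π ∧
      ∀ x, ∀ y ∈ K, ⟪x - π x, y - π x⟫ ≤ 0 := by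
  choose π hπ hmin using exists_norm_eq_iInf_of_complete_convex hne hcl.isComplete hconv
  have hinner := fun x => (norm_eq_iInf_iff_real_inner_le_zero hconv (hπ x)).1 (hmin x)
  refine ⟨π, hπ, LipschitzWith.of_dist_le_mul fun x y => ?_, hinner⟩
  rw [NNReal.coe_one, one_mul, dist_eq_norm, dist_eq_norm]
  have h1 := hinner x (π y) (hπ y)
  have h2 := hinner y (π x) (hπ x)
  have h3 : ‖π x - π y‖ * ‖π x - π y‖ ≤ ‖x - y‖ * ‖π x - π y‖ := by
    rw [← real_inner_self_eq_norm_mul_norm]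
    refine le_trans ?_ (real_inner_le_norm _ _)
    have h4 : ⟪x - y, π x - π y⟫ - ⟪π x - π y, π x - π y⟫ =
        -(⟪x - π x, π y - π x⟫ + ⟪y - π y, π x - π y⟫) := by
      simp only [inner_sub_left, inner_sub_right]
      ring
    linarith
  rcases (norm_nonneg (π x - π y)).eq_or_lt with h0 | h0
  · rw [← h0]
    exact norm_nonneg _
  · exact le_of_mul_le_mul_right h3 h0

theorem ContinuousLinearMap.exists_polynomial_det_one_add_smul {E : Type*} [NormedAddCommGroup E]
    [NormedSpace ℝ E] [FiniteDimensional ℝ E] (A : E →L[ℝ] E) :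
    ∃ P : Polynomial ℝ, P.natDegree ≤ Module.finrank ℝ E ∧
      ∀ t : ℝ, P.eval t = (1 + t • A).det := by
  let b := Module.finBasis ℝ E
  let M := LinearMap.toMatrix b b A.toLinearMap
  refine ⟨((Polynomial.X : Polynomial ℝ) • M.map Polynomial.C +
    (1 : Matrix _ _ ℝ).map Polynomial.C).det, ?_, fun t => ?_⟩
  · simpa using Polynomial.natDegree_det_X_add_C_le M 1
  · rw [ContinuousLinearMap.det, ← LinearMap.det_toMatrix b, ← Polynomial.coe_evalRingHom,
      RingHom.map_det]
    congr 1
    have h : LinearMap.toMatrix b b ((1 + t • A : E →L[ℝ] E) : E →ₗ[ℝ] E) = 1 + t • M := by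
      rw [← LinearMap.toMatrix_one b, ← map_smul, ← map_add]
      rfl
    rw [h]
    ext i j
    by_cases hij : i = j
    · subst hij
      simp
      ring
    · simp [hij, mul_comm t]

/-- `det (1 + A)` is a fixed affine combination of values `det (1 + t • A)` with `t` small. -/
theorem ContinuousLinearMap.exists_det_one_add_eq_sum (E : Type*) [NormedAddCommGroup E]
    [NormedSpace ℝ E] [FiniteDimensional ℝ E] {ε : ℝ} (hε : 0 < ε) :
    ∃ (s : Finset ℕ) (t w : ℕ → ℝ), (∀ j ∈ s, 0 ≤ t j ∧ t j ≤ ε) ∧ ∑ j ∈ s, w j = 1 ∧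
      ∀ A : E →L[ℝ] E, (1 + A).det = ∑ j ∈ s, w j * (1 + t j • A).det := by
  let d := Module.finrank ℝ E
  let s := range (d + 1)
  let t : ℕ → ℝ := fun j => ε * (j / (d + 1))
  have hinj : Set.InjOn t s := by
    intro i _ j _ hij
    have h1 : (i : ℝ) / (d + 1) = j / (d + 1) := mul_left_cancel₀ hε.ne' hij
    rw [div_left_inj' (by positivity)] at h1
    exact_mod_cast h1
  refine ⟨s, t, fun j => (Lagrange.basis s t j).eval 1, fun j hj => ⟨by positivity, ?_⟩, ?_,
    fun A => ?_⟩
  · refine mul_le_of_le_one_right hε.le ((div_le_one (by positivity)).2 ?_)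
    exact_mod_cast (mem_range.1 hj).le
  · rw [← Polynomial.eval_finsetSum, Lagrange.sum_basis hinj ⟨0, by simp [s]⟩, Polynomial.eval_one]
  · obtain ⟨P, hP, hPA⟩ := A.exists_polynomial_det_one_add_smul
    have hdeg : P.degree < #s := by
      refine lt_of_le_of_lt Polynomial.degree_le_natDegree ?_
      simp only [s, card_range]
      exact_mod_cast Nat.lt_succ_of_le hP
    have h := congrArg (Polynomial.eval 1) (Lagrange.eq_interpolate hinj hdeg)
    rw [Lagrange.interpolate_apply, Polynomial.eval_finsetSum, hPA, one_smul] at h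
    rw [h]
    refine Finset.sum_congr rfl fun j _ => ?_
    rw [Polynomial.eval_mul, Polynomial.eval_C, hPA, mul_comm]

variable {E : Type*} [NormedAddCommGroup E] [InnerProductSpace ℝ E] [FiniteDimensional ℝ E]

/-- If `v` vanishes on the sphere, small perturbations `x + t • v x` of the identity map the open
ball bijectively onto itself. -/
theorem image_ball_add_smul_eq {R : ℝ} (hR : 0 < R) {v : E → E} {C : ℝ≥0}
    (hv : LipschitzOnWith C v (closedBall 0 R)) (h0 : ∀ x, ‖x‖ = R → v x = 0) {t : ℝ}
    (ht : 0 ≤ t) (htC : t * C < 1) :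
    Set.InjOn (fun x => x + t • v x) (ball 0 R) ∧ (fun x => x + t • v x) '' ball 0 R = ball 0 R := by
  obtain ⟨π, hπ, hπL, hπi⟩ := Convex.exists_nearest_point (E := E) (K := closedBall 0 R)
    ⟨0, by simp [hR.le]⟩ isClosed_closedBall (convex_closedBall 0 R)
  have hπid : ∀ x ∈ closedBall (0 : E) R, π x = x := fun x hx =>
    (sub_eq_zero.1 (real_inner_self_nonpos.1 (hπi x x hx))).symm
  have hπR : ∀ x, x ∉ ball (0 : E) R → ‖π x‖ = R := by
    intro x hx
    have h1 : ‖π x‖ ≤ R := by simpa using hπ x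
    by_contra hne
    have h2 : ‖π x‖ < R := lt_of_le_of_ne h1 hne
    have h3 : 0 < ‖x - π x‖ := norm_pos_iff.2 fun h => hx (by
      rw [mem_ball_zero_iff, sub_eq_zero.1 h]
      exact h2)
    have h4 := hπi x (π x + ((R - ‖π x‖) / ‖x - π x‖) • (x - π x)) (by
      rw [mem_closedBall_zero_iff]
      refine (norm_add_le _ _).trans ?_
      rw [norm_smul, Real.norm_of_nonneg (div_nonneg (sub_nonneg.2 h1) h3.le),
        div_mul_cancel₀ _ h3.ne']
      linarith)
    rw [add_sub_cancel_left, inner_smul_right, real_inner_self_eq_norm_mul_norm] at h4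
    have : 0 < (R - ‖π x‖) / ‖x - π x‖ * (‖x - π x‖ * ‖x - π x‖) := by
      have := sub_pos.2 h2
      positivity
    linarith
  set g : E → E := fun x => v (π x)
  have hg : LipschitzWith C g := by
    refine LipschitzWith.of_dist_le_mul fun x y => (hv.dist_le_mul _ (hπ x) _ (hπ y)).trans ?_
    have := hπL.dist_le_mul x y
    rw [NNReal.coe_one, one_mul] at this
    gcongr
  have hg0 : ∀ x, x ∉ ball (0 : E) R → g x = 0 := fun x hx => h0 _ (hπR x hx)
  have hgv : ∀ x ∈ ball (0 : E) R, g x = v x := fun x hx => by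
    simp only [g, hπid x (ball_subset_closedBall hx)]
  have hinj : Function.Injective fun x => x + t • g x := by
    intro x y hxy
    have h1 : x - y = t • (g y - g x) := by
      rw [smul_sub, sub_eq_sub_iff_add_eq_add, add_comm (t • g y)]
      exact hxy
    have h2 : ‖x - y‖ ≤ t * C * ‖x - y‖ := by
      conv_lhs => rw [h1, norm_smul, Real.norm_of_nonneg ht]
      rw [mul_assoc]
      gcongr
      rw [← dist_eq_norm, ← dist_eq_norm, dist_comm x]
      exact hg.dist_le_mul _ _
    have h3 : ‖x - y‖ ≤ 0 := by nlinarith [norm_nonneg (x - y)]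
    exact sub_eq_zero.1 (norm_le_zero_iff.1 h3)
  have hsurj : Function.Surjective fun x => x + t • g x := by
    intro y
    have hc : ContractingWith (t.toNNReal * C) fun x => y - t • g x := by
      refine ⟨by rwa [← NNReal.coe_lt_one, NNReal.coe_mul, Real.coe_toNNReal t ht],
        LipschitzWith.of_dist_le_mul fun a b => ?_⟩
      rw [dist_sub_left, dist_smul₀, Real.norm_of_nonneg ht, NNReal.coe_mul,
        Real.coe_toNNReal t ht, mul_assoc]
      exact mul_le_mul_of_nonneg_left (hg.dist_le_mul _ _) ht
    have h := hc.fixedPoint_isFixedPt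
    refine ⟨_, eq_sub_iff_add_eq.1 h.symm⟩
  have heq : Set.EqOn (fun x => x + t • g x) (fun x => x + t • v x) (ball 0 R) := fun x hx => by
    simp only [hgv x hx]
  have hmem : ∀ x, x + t • g x ∈ ball (0 : E) R ↔ x ∈ ball (0 : E) R := by
    intro x
    by_cases hx : x ∈ ball (0 : E) R
    · refine iff_of_true (by_contra fun hy => ?_) hx
      have h1 : (x + t • g x) + t • g (x + t • g x) = x + t • g x := by
        rw [hg0 _ hy, smul_zero, add_zero]
      rw [hinj h1] at hy
      exact hy hx
    · rw [hg0 x hx, smul_zero, add_zero]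
  refine ⟨(hinj.injOn).congr heq, ?_⟩
  rw [← heq.image_eq]
  ext y
  constructor
  · rintro ⟨x, hx, rfl⟩
    exact (hmem x).2 hx
  · intro hy
    obtain ⟨x, rfl⟩ := hsurj y
    exact ⟨x, (hmem x).1 hy, rfl⟩

/-- There is no continuously differentiable map onto a sphere that fixes the sphere. -/
theorem not_exists_contDiff_retraction {R : ℝ} (hR : 0 < R) {r : E → E} (hr : ContDiff ℝ 1 r)
    (hnorm : ∀ x, ‖r x‖ = R) (hid : ∀ x, ‖x‖ = R → r x = x) : False := by
  borelize E
  let μ : Measure E := Measure.addHaar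
  have hrd : ∀ x, HasFDerivAt r (fderiv ℝ r x) x := fun x =>
    (hr.differentiable one_ne_zero x).hasFDerivAt
  let A : E → E →L[ℝ] E := fun x => fderiv ℝ r x - 1
  have hA : Continuous A := (hr.continuous_fderiv one_ne_zero).sub continuous_const
  have hvd : ∀ x, HasFDerivAt (fun x => r x - x) (A x) x := fun x => (hrd x).sub (hasFDerivAt_id x)
  have hdet0 : ∀ x, (1 + A x).det = 0 := by
    intro x
    by_contra h
    have h1 : 1 + A x = fderiv ℝ r x := add_sub_cancel _ _
    rw [h1] at h
    obtain ⟨w, hw⟩ := ((fderiv ℝ r x).toContinuousLinearEquivOfDetNeZero h).surjective (r x)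
    have hw' : fderiv ℝ r x w = r x := hw
    have h2 := (hrd x).norm_sq
    simp only [hnorm] at h2
    have h3 := congrArg (fun L : E →L[ℝ] ℝ => L w) (h2.unique (hasFDerivAt_const (R ^ 2) x))
    simp [hw', hnorm, hR.ne'] at h3
  obtain ⟨C, hC⟩ := (isCompact_closedBall (0 : E) R).exists_bound_of_continuousOn hA.continuousOn
  set C' : ℝ≥0 := C.toNNReal
  have hC' : ∀ x ∈ closedBall (0 : E) R, ‖A x‖ ≤ C' := fun x hx =>
    (hC x hx).trans (Real.le_coe_toNNReal C)
  have hlip : LipschitzOnWith C' (fun x => r x - x) (closedBall 0 R) :=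
    (convex_closedBall (0 : E) R).lipschitzOnWith_of_nnnorm_hasFDerivWithin_le
      (fun x _ => (hvd x).hasFDerivWithinAt) hC'
  obtain ⟨δ, hδ, hdetpos⟩ := Metric.eventually_nhds_iff.1
    ((ContinuousLinearMap.continuous_det.tendsto (1 : E →L[ℝ] E)).eventually_const_lt
      (show (0 : ℝ) < (1 : E →L[ℝ] E).det by simp [ContinuousLinearMap.det]))
  set ε := min 1 δ / (2 * (C' + 1))
  have hε : 0 < ε := by positivity
  have hεC : ∀ t ≤ ε, t * C' < min 1 δ := fun t ht => by
    have h1 : ε * (2 * (C' + 1)) = min 1 δ := div_mul_cancel₀ _ (by positivity)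
    have h2 : t * C' ≤ ε * C' := by gcongr
    nlinarith [C'.2]
  obtain ⟨s, t, w, ht, hw, hsum⟩ := ContinuousLinearMap.exists_det_one_add_eq_sum E hε
  have hcont : ∀ τ : ℝ, Continuous fun x => (1 + τ • A x).det := fun τ =>
    ContinuousLinearMap.continuous_det.comp (continuous_const.add (hA.const_smul τ))
  have hvol : ∀ τ : ℝ, 0 ≤ τ → τ ≤ ε →
      ∫ x in ball (0 : E) R, (1 + τ • A x).det ∂μ = μ.real (ball 0 R) := by
    intro τ hτ hτε
    have hτC := hεC τ hτε
    obtain ⟨hinj, himg⟩ := image_ball_add_smul_eq hR hlip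
      (fun x hx => by rw [hid x hx, sub_self]) hτ (hτC.trans_le (min_le_left _ _))
    have h := integral_image_eq_integral_abs_det_fderiv_smul μ measurableSet_ball
      (f := fun x => x + τ • (r x - x)) (f' := fun x => 1 + τ • A x) (fun x _ =>
        ((hasFDerivAt_id x).add ((hvd x).const_smul τ)).hasFDerivWithinAt) hinj (fun _ => (1 : ℝ))
    rw [himg] at h
    simp only [smul_eq_mul, mul_one, integral_const, measureReal_restrict_apply_univ] at h
    rw [h]
    refine setIntegral_congr_fun measurableSet_ball fun x hx => (abs_of_pos (hdetpos ?_)).symm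
    rw [dist_eq_norm, add_sub_cancel_left, norm_smul, Real.norm_of_nonneg hτ]
    calc τ * ‖A x‖ ≤ τ * C' := by
          gcongr
          exact hC' x (ball_subset_closedBall hx)
      _ < δ := hτC.trans_le (min_le_right _ _)
  have hinteg : ∀ τ : ℝ, IntegrableOn (fun x => (1 + τ • A x).det) (ball (0 : E) R) μ := fun τ =>
    ((hcont τ).continuousOn.integrableOn_compact (isCompact_closedBall 0 R)).mono_set
      ball_subset_closedBall
  have h0 : (0 : ℝ) = ∑ j ∈ s, w j * μ.real (ball 0 R) := by
    calc (0 : ℝ) = ∫ x in ball (0 : E) R, (1 + A x).det ∂μ :=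
        ((integral_congr_ae (.of_forall hdet0)).trans (integral_zero _ _)).symm
      _ = ∫ x in ball (0 : E) R, ∑ j ∈ s, w j * (1 + t j • A x).det ∂μ :=
        integral_congr_ae (.of_forall fun x => hsum (A x))
      _ = ∑ j ∈ s, ∫ x in ball (0 : E) R, w j * (1 + t j • A x).det ∂μ :=
        integral_finsetSum _ fun j _ => (hinteg (t j)).const_mul (w j)
      _ = _ := Finset.sum_congr rfl fun j hj => by
        rw [integral_const_mul, hvol _ (ht j hj).1 (ht j hj).2]
  rw [← Finset.sum_mul, hw, one_mul] at h0
  have : 0 < μ.real (ball (0 : E) R) :=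
    ENNReal.toReal_pos (measure_ball_pos μ _ hR).ne' measure_ball_lt_top.ne
  exact this.ne h0

/-- **Brouwer's fixed point theorem** for bounded continuous self-maps. -/
theorem Continuous.exists_fixedPoint_of_norm_le {f : E → E} (hf : Continuous f) {M : ℝ}
    (hM : ∀ x, ‖f x‖ ≤ M) : ∃ x, f x = x := by
  by_contra! hne
  have hM0 : 0 ≤ M := (norm_nonneg _).trans (hM 0)
  obtain ⟨g, hg, hgf, -⟩ := hf.exists_contDiff_approx (ε := fun x => min 1 ‖f x - x‖) 1
    (by fun_prop) fun x => lt_min one_pos (norm_pos_iff.2 (sub_ne_zero.2 (hne x)))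
  have hgM : ∀ x, ‖g x‖ < M + 1 := fun x => by
    have h1 := (hgf x).trans_le (min_le_left _ _)
    rw [dist_eq_norm] at h1
    have h2 := norm_sub_norm_le (g x) (f x)
    linarith [hM x]
  have hgx : ∀ x, x ≠ g x := fun x h => by
    have h1 := (hgf x).trans_le (min_le_right _ _)
    rw [dist_comm, dist_eq_norm, ← h] at h1
    exact lt_irrefl _ h1
  let χ : ContDiffBump (0 : E) := ⟨M + 1, M + 2, by positivity, by linarith⟩
  have hR : 0 < M + 2 := by positivity
  let h : E → E := fun x => x - χ x • g x
  have hh : ContDiff ℝ 1 h := contDiff_id.sub (χ.contDiff.smul hg)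
  have hh0 : ∀ x, h x ≠ 0 := by
    intro x hx
    have hx' : x = χ x • g x := sub_eq_zero.1 hx
    by_cases hle : ‖x‖ ≤ M + 1
    · rw [χ.one_of_mem_closedBall (by simpa using hle), one_smul] at hx'
      exact hgx x hx'
    · refine hle ?_
      calc ‖x‖ = ‖χ x • g x‖ := congrArg _ hx'
        _ = χ x * ‖g x‖ := by rw [norm_smul, Real.norm_of_nonneg χ.nonneg]
        _ ≤ 1 * ‖g x‖ := by
          gcongr
          exact χ.le_one
        _ ≤ M + 1 := by linarith [hgM x]
  refine not_exists_contDiff_retraction hR (r := fun x => ((M + 2) * ‖h x‖⁻¹) • h x)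
    ((contDiff_const.mul ((hh.norm ℝ hh0).inv fun x => norm_ne_zero_iff.2 (hh0 x))).smul hh)
    (fun x => ?_) fun x hx => ?_
  · rw [norm_smul, norm_mul, norm_inv, norm_norm, inv_mul_cancel_right₀ (norm_ne_zero_iff.2 (hh0 x)),
      Real.norm_of_nonneg hR.le]
  · have h1 : h x = x := by
      have : χ x = 0 := χ.zero_of_le_dist (by simp [χ, hx])
      simp [h, this]
    rw [h1, hx, mul_inv_cancel₀ hR.ne', one_smul]

/-- Variational inequalities on nonempty compact convex sets are solvable. -/
theorem Continuous.exists_variational_inequality {F : E → E} (hF : Continuous F) {K : Set E}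
    (hne : K.Nonempty) (hK : IsCompact K) (hconv : Convex ℝ K) :
    ∃ x ∈ K, ∀ y ∈ K, ⟪F x, y - x⟫ ≤ 0 := by
  obtain ⟨π, hπ, hπL, hπi⟩ := Convex.exists_nearest_point hne hK.isClosed hconv
  obtain ⟨M, hM⟩ := hK.isBounded.exists_norm_le
  obtain ⟨x, hx⟩ := Continuous.exists_fixedPoint_of_norm_le
    (f := fun x => π (π x + F (π x)))
    (hπL.continuous.comp (hπL.continuous.add (hF.comp hπL.continuous))) (fun x => hM _ (hπ _))
  have hxK : x ∈ K := hx ▸ hπ _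
  have hπx : π x = x := (sub_eq_zero.1 (real_inner_self_nonpos.1 (hπi x x hxK))).symm
  refine ⟨x, hxK, fun y hy => ?_⟩
  have h := hπi (π x + F (π x)) y hy
  rw [hx, hπx] at h
  simpa using h

end Brouwer

section PolynomialFunctions

/-- A function on `ι → ℝ` given by a polynomial with coefficients in the subfield `K`. -/
def IsPolynomialFun (K : Subfield ℝ) {ι : Type*} (g : (ι → ℝ) → ℝ) : Prop :=
  ∃ P : MvPolynomial ι K, ∀ x, MvPolynomial.aeval x P = g x

namespace IsPolynomialFun

variable {K : Subfield ℝ} {ι : Type*} {f g : (ι → ℝ) → ℝ}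

theorem const {c : ℝ} (hc : c ∈ K) : IsPolynomialFun K fun _ : ι → ℝ => c :=
  ⟨MvPolynomial.C ⟨c, hc⟩, fun x => MvPolynomial.aeval_C x _⟩

theorem apply (i : ι) : IsPolynomialFun K fun x : ι → ℝ => x i :=
  ⟨MvPolynomial.X i, fun x => MvPolynomial.aeval_X x i⟩

theorem mul (hf : IsPolynomialFun K f) (hg : IsPolynomialFun K g) :
    IsPolynomialFun K fun x => f x * g x := by
  obtain ⟨P, hP⟩ := hf
  obtain ⟨Q, hQ⟩ := hg
  exact ⟨P * Q, fun x => by rw [map_mul, hP, hQ]⟩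

theorem sub (hf : IsPolynomialFun K f) (hg : IsPolynomialFun K g) :
    IsPolynomialFun K fun x => f x - g x := by
  obtain ⟨P, hP⟩ := hf
  obtain ⟨Q, hQ⟩ := hg
  exact ⟨P - Q, fun x => by rw [map_sub, hP, hQ]⟩

theorem sum {κ : Type*} (s : Finset κ) {F : κ → (ι → ℝ) → ℝ} (hF : ∀ k, IsPolynomialFun K (F k)) :
    IsPolynomialFun K fun x => ∑ k ∈ s, F k x := by
  choose P hP using hF
  exact ⟨∑ k ∈ s, P k, fun x => by simp only [map_sum, hP]⟩

theorem prod {κ : Type*} (s : Finset κ) {F : κ → (ι → ℝ) → ℝ} (hF : ∀ k, IsPolynomialFun K (F k)) :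
    IsPolynomialFun K fun x => ∏ k ∈ s, F k x := by
  choose P hP using hF
  exact ⟨∏ k ∈ s, P k, fun x => by simp only [map_prod, hP]⟩

theorem continuous (hf : IsPolynomialFun K f) : Continuous f := by
  obtain ⟨P, hP⟩ := hf
  obtain rfl : (fun x => MvPolynomial.aeval x P) = f := funext hP
  simp only [MvPolynomial.aeval_def, MvPolynomial.eval₂_eq_eval_map]
  exact MvPolynomial.continuous_eval _

/-- Solvability of finitely many polynomial equations and weak inequalities descends to a
relatively algebraically closed subfield of `ℝ`. -/
theorem exists_mem_subfield [Fintype ι]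
    (hK : ∀ P : Polynomial ℝ, P ≠ 0 → (∀ i, P.coeff i ∈ K) → ∀ x, P.IsRoot x → x ∈ K)
    {κ : Type*} [Finite κ] {F : κ → (ι → ℝ) → ℝ} (hF : ∀ k, IsPolynomialFun K (F k)) (x : ι → ℝ) :
    ∃ y : ι → ℝ, (∀ i, y i ∈ K) ∧ ∀ k, (F k x = 0 → F k y = 0) ∧ (0 ≤ F k x → 0 ≤ F k y) := by
  choose P hP using hF
  obtain ⟨y, hyK, hy⟩ := MvPolynomial.exists_mem_subfield hK x (Set.finite_range P)
  refine ⟨y, hyK, fun k => ?_⟩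
  obtain ⟨h1, h2⟩ := hy (P k) ⟨k, rfl⟩
  rw [hP, hP] at h1 h2
  exact ⟨h1, fun h => h.eq_or_lt.elim (fun h0 => (h1 h0.symm).ge) fun h0 => (h2 h0).le⟩

end IsPolynomialFun

end PolynomialFunctions

/-- Variational inequalities on compact convex sets of real vectors are solvable. -/
theorem Continuous.exists_sum_mul_sub_nonpos {ι : Type*} [Fintype ι] {F : (ι → ℝ) → ι → ℝ}
    (hF : Continuous F) {K : Set (ι → ℝ)} (hne : K.Nonempty) (hK : IsCompact K)
    (hconv : Convex ℝ K) : ∃ x ∈ K, ∀ y ∈ K, ∑ i, F x i * (y i - x i) ≤ 0 := by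
  let e := EuclideanSpace.equiv ι ℝ
  obtain ⟨x, hx, h⟩ := Continuous.exists_variational_inequality (K := e ⁻¹' K)
    (F := fun x => e.symm (F (e x))) (by fun_prop) (hne.preimage e.surjective)
    (e.toHomeomorph.isCompact_preimage.2 hK) (hconv.linear_preimage e.toLinearMap)
  refine ⟨e x, hx, fun y hy => ?_⟩
  have h1 := h (e.symm y) (by simpa using hy)
  simpa [PiLp.inner_apply, mul_comm, e] using h1

section BayesianGame

open Function

variable {m : ℕ} {T A : Fin m → Type*} [∀ i, Fintype (A i)]

/-- The profile encoded by a vector indexed by player, type and action. -/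
def bayesProfile (x : (Σ i, T i × A i) → ℝ) : ∀ i, T i → A i → ℝ :=
  fun i t a => x ⟨i, t, a⟩

theorem isCompact_setOf_isBehavioral :
    IsCompact {x : (Σ i, T i × A i) → ℝ | ∀ i, IsBehavioral (bayesProfile x i)} := by
  refine (isCompact_univ_pi fun _ => isCompact_Icc (a := (0 : ℝ)) (b := 1)).of_isClosed_subset
    ?_ ?_
  · simp only [IsBehavioral, IsDist, bayesProfile, Set.ofPred_forall, Set.ofPred_and]
    refine isClosed_iInter fun i => isClosed_iInter fun t => IsClosed.inter
      (isClosed_iInter fun a => isClosed_le continuous_const (continuous_apply _))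
      (isClosed_eq (continuous_finsetSum _ fun a _ => continuous_apply _) continuous_const)
  · rintro x hx ⟨i, t, a⟩ -
    refine ⟨(hx i t).1 a, ?_⟩
    rw [← (hx i t).2]
    exact Finset.single_le_sum (f := bayesProfile x i t) (fun b _ => (hx i t).1 b) (mem_univ a)

theorem convex_setOf_isBehavioral :
    Convex ℝ {x : (Σ i, T i × A i) → ℝ | ∀ i, IsBehavioral (bayesProfile x i)} := by
  intro x hx y hy a b ha hb hab i t
  refine ⟨fun s => add_nonneg (mul_nonneg ha ((hx i t).1 s)) (mul_nonneg hb ((hy i t).1 s)), ?_⟩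
  calc ∑ s, (a * bayesProfile x i t s + b * bayesProfile y i t s)
      = a * ∑ s, bayesProfile x i t s + b * ∑ s, bayesProfile y i t s := by
        rw [Finset.sum_add_distrib, Finset.mul_sum, Finset.mul_sum]
    _ = 1 := by rw [(hx i t).2, (hy i t).2, mul_one, mul_one, hab]

variable [∀ i, Fintype (T i)]

/-- The contribution to the expected utility of player `i` of the event that player `i` has type
`ti`, if action `ai` is then played with certainty. -/
noncomputable def bayesTypePayoff (p : (∀ i, T i) → ℝ) (u : Fin m → (∀ i, T i) → (∀ i, A i) → ℝ)
    (σ : ∀ i, T i → A i → ℝ) (i : Fin m) (ti : T i) (ai : A i) : ℝ :=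
  open Classical in
  ∑ t : ∀ j, T j, ∑ a : ∀ j, A j, if t i = ti ∧ a i = ai then
    p t * ((∏ j ∈ univ.erase i, σ j (t j) (a j)) * u i t a) else 0

theorem bayesExpUtil_update (p : (∀ i, T i) → ℝ) (u : Fin m → (∀ i, T i) → (∀ i, A i) → ℝ)
    (σ : ∀ i, T i → A i → ℝ) (i : Fin m) (τ : T i → A i → ℝ) :
    bayesExpUtil p u (update σ i τ) i =
      ∑ ti, ∑ ai, τ ti ai * bayesTypePayoff p u σ i ti ai := by
  classical
  have hprod : ∀ (t : ∀ j, T j) (a : ∀ j, A j), ∏ j, update σ i τ j (t j) (a j) =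
      τ (t i) (a i) * ∏ j ∈ univ.erase i, σ j (t j) (a j) := by
    intro t a
    rw [← Finset.mul_prod_erase univ _ (mem_univ i), update_self]
    congr 1
    exact Finset.prod_congr rfl fun j hj => by rw [update_of_ne (ne_of_mem_erase hj)]
  set G : (∀ j, T j) → (∀ j, A j) → ℝ :=
    fun t a => p t * ((∏ j ∈ univ.erase i, σ j (t j) (a j)) * u i t a)
  have hterm : ∀ t a, τ (t i) (a i) * G t a =
      ∑ ti, ∑ ai, τ ti ai * if t i = ti ∧ a i = ai then G t a else 0 := by
    intro t a
    rw [Finset.sum_eq_single (t i), Finset.sum_eq_single (a i)]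
    · simp
    · intro b _ hb
      simp [hb.symm]
    · simp
    · intro b _ hb
      simp [hb.symm]
    · simp
  calc bayesExpUtil p u (update σ i τ) i = ∑ t, ∑ a, τ (t i) (a i) * G t a := by
        refine Finset.sum_congr rfl fun t _ => ?_
        rw [Finset.mul_sum]
        refine Finset.sum_congr rfl fun a _ => ?_
        rw [hprod]
        ring
    _ = ∑ x : (∀ j, T j) × (∀ j, A j), ∑ y : T i × A i,
          τ y.1 y.2 * if x.1 i = y.1 ∧ x.2 i = y.2 then G x.1 x.2 else 0 := by
        simp only [hterm, Fintype.sum_prod_type]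
    _ = ∑ y : T i × A i, ∑ x : (∀ j, T j) × (∀ j, A j),
          τ y.1 y.2 * if x.1 i = y.1 ∧ x.2 i = y.2 then G x.1 x.2 else 0 := Finset.sum_comm
    _ = _ := by
        simp only [Fintype.sum_prod_type, ← Finset.mul_sum]
        rfl

/-- A behavioral profile is an equilibrium as soon as no type of any player gains by deviating to
a pure action. -/
theorem bayesExpUtil_update_le {p : (∀ i, T i) → ℝ} {u : Fin m → (∀ i, T i) → (∀ i, A i) → ℝ}
    {σ : ∀ i, T i → A i → ℝ} {i : Fin m}
    (h : ∀ ti ai, bayesTypePayoff p u σ i ti ai ≤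
      ∑ b, σ i ti b * bayesTypePayoff p u σ i ti b)
    {τ : T i → A i → ℝ} (hτ : IsBehavioral τ) :
    bayesExpUtil p u (update σ i τ) i ≤ bayesExpUtil p u σ i := by
  conv_rhs => rw [← update_eq_self i σ]
  rw [bayesExpUtil_update, bayesExpUtil_update]
  refine Finset.sum_le_sum fun ti _ => ?_
  calc ∑ ai, τ ti ai * bayesTypePayoff p u σ i ti ai
      ≤ ∑ ai, τ ti ai * ∑ b, σ i ti b * bayesTypePayoff p u σ i ti b :=
        Finset.sum_le_sum fun ai _ => mul_le_mul_of_nonneg_left (h ti ai) ((hτ ti).1 ai)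
    _ = _ := by rw [← Finset.sum_mul, (hτ ti).2, one_mul]

theorem isPolynomialFun_bayesTypePayoff {K : Subfield ℝ} {p : (∀ i, T i) → ℝ}
    (hp : ∀ t, p t ∈ K) {u : Fin m → (∀ i, T i) → (∀ i, A i) → ℝ} (hu : ∀ i t a, u i t a ∈ K)
    (i : Fin m) (ti : T i) (ai : A i) :
    IsPolynomialFun K fun x => bayesTypePayoff p u (bayesProfile x) i ti ai := by
  classical
  refine .sum _ fun t => .sum _ fun a => ?_
  by_cases h : t i = ti ∧ a i = ai
  · simp only [h, and_self, if_true]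
    exact (IsPolynomialFun.const (hp t)).mul
      ((IsPolynomialFun.prod _ fun j => .apply _).mul (.const (hu i t a)))
  · simp only [h, if_false]
    exact .const K.zero_mem

theorem isDist_single {S : Type*} [Fintype S] [DecidableEq S] (s : S) :
    IsDist (Pi.single s (1 : ℝ)) :=
  ⟨fun b => by
    rw [Pi.single_apply]
    split_ifs <;> norm_num, by simp⟩

theorem exists_bayesTypePayoff_le [∀ i, Nonempty (A i)] {p : (∀ i, T i) → ℝ}
    {u : Fin m → (∀ i, T i) → (∀ i, A i) → ℝ} :
    ∃ x : (Σ i, T i × A i) → ℝ, (∀ i, IsBehavioral (bayesProfile x i)) ∧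
      ∀ i ti ai, bayesTypePayoff p u (bayesProfile x) i ti ai ≤
        ∑ b, bayesProfile x i ti b * bayesTypePayoff p u (bayesProfile x) i ti b := by
  classical
  have hne : {x : (Σ i, T i × A i) → ℝ | ∀ i, IsBehavioral (bayesProfile x i)}.Nonempty :=
    ⟨fun z => (Pi.single (Classical.arbitrary (A z.1)) 1 : A z.1 → ℝ) z.2.2,
      fun i t => isDist_single (Classical.arbitrary (A i))⟩
  obtain ⟨x, hx, h⟩ := Continuous.exists_sum_mul_sub_nonpos
    (F := fun x z => bayesTypePayoff p u (bayesProfile x) z.1 z.2.1 z.2.2)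
    (continuous_pi fun z => (isPolynomialFun_bayesTypePayoff (K := ⊤) (fun _ => Subfield.mem_top _)
      (fun _ _ _ => Subfield.mem_top _) z.1 z.2.1 z.2.2).continuous)
    hne
    isCompact_setOf_isBehavioral (convex_setOf_isBehavioral (T := T) (A := A))
  refine ⟨x, hx, fun i ti ai => ?_⟩
  set W := bayesTypePayoff p u (bayesProfile x)
  let τ := update (bayesProfile x) i (update (bayesProfile x i) ti (Pi.single ai 1))
  have hτ : ∀ j, IsBehavioral (τ j) := by
    intro j t
    rcases eq_or_ne j i with rfl | hj
    · rcases eq_or_ne t ti with rfl | ht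
      · simpa [τ] using isDist_single ai
      · simpa [τ, ht] using hx j t
    · simpa [τ, hj] using hx j t
  have h1 := h (fun z => τ z.1 z.2.1 z.2.2) hτ
  have h2 : ∑ z : Σ i, T i × A i, W z.1 z.2.1 z.2.2 * (τ z.1 z.2.1 z.2.2 - x z) =
      ∑ b, W i ti b * ((Pi.single ai 1 : A i → ℝ) b - bayesProfile x i ti b) := by
    rw [Fintype.sum_sigma, Finset.sum_eq_single i, Fintype.sum_prod_type,
      Finset.sum_eq_single ti]
    · simp [τ, bayesProfile]
    · intro t _ ht
      simp [τ, ht, bayesProfile]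
    · simp
    · intro j _ hj
      simp [τ, hj, bayesProfile]
    · simp
  rw [h2] at h1
  simp only [mul_sub, Finset.sum_sub_distrib] at h1
  rw [Finset.sum_eq_single ai (fun b _ hb => by simp [hb]) (by simp), Pi.single_eq_same,
    mul_one] at h1
  simpa only [mul_comm] using sub_nonpos.1 h1

end BayesianGame

/-- Every finite Bayesian game whose prior probabilities and utility values are
all computable reals has a behavioral-strategy Nash equilibrium in which every
probability is a computable real. -/
theorem exists_computable_bayesian_nash_equilibrium
    (m : ℕ) (T A : Fin m → Type*)
    [∀ i, Fintype (T i)] [∀ i, Nonempty (T i)]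
    [∀ i, Fintype (A i)] [∀ i, Nonempty (A i)]
    (p : (∀ i, T i) → ℝ) (hp : IsDist p)
    (hpc : ∀ t, ComputableReal (p t))
    (u : Fin m → (∀ i, T i) → (∀ i, A i) → ℝ)
    (huc : ∀ i t a, ComputableReal (u i t a)) :
    ∃ σ : ∀ i, T i → A i → ℝ, (∀ i, IsBehavioral (σ i)) ∧
      (∀ (i : Fin m) (ti : T i) (ai : A i), ComputableReal (σ i ti ai)) ∧
      ∀ (i : Fin m) (σ'i : T i → A i → ℝ), IsBehavioral σ'i →
        bayesExpUtil p u σ i ≥ bayesExpUtil p u (Function.update σ i σ'i) i := by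
  obtain ⟨x, hx, hxW⟩ := exists_bayesTypePayoff_le (p := p) (u := u)
  have hW := isPolynomialFun_bayesTypePayoff (K := computableReals) hpc huc
  let F : (Σ i, T i × A i) ⊕ (Σ i, T i) ⊕ (Σ i, T i × A i) → ((Σ i, T i × A i) → ℝ) → ℝ :=
    Sum.elim (fun z y => y z) (Sum.elim (fun z y => ∑ b, y ⟨z.1, z.2, b⟩ - 1)
      fun z y => ∑ b, y ⟨z.1, z.2.1, b⟩ * bayesTypePayoff p u (bayesProfile y) z.1 z.2.1 b -
        bayesTypePayoff p u (bayesProfile y) z.1 z.2.1 z.2.2)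
  have hF : ∀ k, IsPolynomialFun computableReals (F k) := by
    rintro (z | z | z)
    · exact .apply z
    · exact (IsPolynomialFun.sum _ fun b => .apply _).sub (.const (one_mem _))
    · exact (IsPolynomialFun.sum _ fun b => (IsPolynomialFun.apply _).mul (hW _ _ _)).sub (hW _ _ _)
  obtain ⟨y, hyc, hy⟩ := IsPolynomialFun.exists_mem_subfield
    (fun P hP hc x hx => ComputableReal.of_isRoot hP hc hx) hF x
  refine ⟨bayesProfile y, fun i t => ⟨fun a => ?_, ?_⟩, fun i ti ai => hyc _, fun i τ hτ => ?_⟩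
  · exact (hy (.inl ⟨i, t, a⟩)).2 ((hx i t).1 a)
  · exact sub_eq_zero.1 ((hy (.inr (.inl ⟨i, t⟩))).1 (sub_eq_zero.2 (hx i t).2))
  · exact bayesExpUtil_update_le (σ := bayesProfile y) (fun ti ai =>
      sub_nonneg.1 ((hy (.inr (.inr ⟨i, ti, ai⟩))).2 (sub_nonneg.2 (hxW i ti ai)))) hτ
end
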